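/- arXiv:1610.04353 — 5 statements merged into one kernel-verified Lean document; each statement's English description precedes it below -/
import Mathlib

section
/- Let k be a field of characteristic zero, ℓ ≥ 1, and let λ be an integer with 1 ≤ λ ≤ ℓ. Then (z_1 + z_2 + ⋯ + z_λ)^{λ(ℓ−λ)} does not belong to I_S; equivalently, the image of z_1 + ⋯ + z_λ in k[z_1,…,z_ℓ]/I_S has nonzero (λ(ℓ−λ))-th power. -/
open MvPolynomial

namespace MvPolynomial

section DifferentialOperators

variable {σ k : Type*} [Field k]

theorem pderiv_pderiv_comm (i j : σ) (f : MvPolynomial σ k) :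
    pderiv i (pderiv j f) = pderiv j (pderiv i f) := by
  have h : ⁅pderiv (R := k) i, pderiv (R := k) j⁆ = 0 := by
    classical
    refine derivation_ext fun l => ?_
    rw [Derivation.commutator_apply, pderiv_X, pderiv_X]
    simp [Pi.single_apply, apply_ite]
  have hh := congrArg (fun D : Derivation k (MvPolynomial σ k) (MvPolynomial σ k) => D f) h
  simpa [Derivation.commutator_apply, sub_eq_zero] using hh

/-- The subalgebra of linear endomorphisms of `k[σ]` generated by the partial derivatives. -/
noncomputable abbrev constCoeffDiffOps (σ k : Type*) [Field k] :
    Subalgebra k (Module.End k (MvPolynomial σ k)) :=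
  Algebra.adjoin k (Set.range fun i : σ => (pderiv (R := k) i).toLinearMap)

instance : IsMulCommutative (constCoeffDiffOps σ k) := by
  refine Algebra.isMulCommutative_adjoin (R := k) ?_
  rintro _ ⟨i, rfl⟩ _ ⟨j, rfl⟩
  exact LinearMap.ext fun f => pderiv_pderiv_comm i j f

open scoped IsMulCommutative in
/-- The differential operator `p(∂)` attached to a polynomial `p`. -/
noncomputable def diffOp : MvPolynomial σ k →ₐ[k] Module.End k (MvPolynomial σ k) :=
  (constCoeffDiffOps σ k).val.comp
    (aeval fun i => (⟨_, Algebra.subset_adjoin ⟨i, rfl⟩⟩ : constCoeffDiffOps σ k))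

open scoped IsMulCommutative in
theorem diffOp_X (i : σ) (f : MvPolynomial σ k) : diffOp (X i) f = pderiv i f := by
  simp [diffOp]

theorem diffOp_C (a : k) (f : MvPolynomial σ k) : diffOp (C a) f = a • f := by
  have : C a = algebraMap k (MvPolynomial σ k) a := rfl
  rw [this, AlgHom.commutes, Module.algebraMap_end_apply]

theorem diffOp_mul (p q f : MvPolynomial σ k) :
    diffOp (p * q) f = diffOp p (diffOp q f) := by
  rw [map_mul, Module.End.mul_apply]

theorem rename_diffOp (e : Equiv.Perm σ) (p f : MvPolynomial σ k) :
    rename e (diffOp p f) = diffOp (rename e p) (rename e f) := by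
  induction p using MvPolynomial.induction_on generalizing f with
  | C a => simp only [diffOp_C, rename_C, map_smul]
  | add p q hp hq => simp only [map_add, LinearMap.add_apply, hp, hq]
  | mul_X p i hp =>
    rw [map_mul (rename e), rename_X, diffOp_mul, diffOp_mul, hp, diffOp_X, diffOp_X,
      pderiv_rename e.injective]

theorem coeff_pderiv_eq_zero {N : ℕ} {f : MvPolynomial σ k}
    (hf : ∀ t : σ →₀ ℕ, N + 1 ≤ t.degree → coeff t f = 0) (i : σ)
    (t : σ →₀ ℕ) (ht : N ≤ t.degree) : coeff t (pderiv i f) = 0 := by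
  rw [coeff_pderiv, hf, zero_mul]
  simpa using ht

theorem coeff_diffOp_eq {N : ℕ} {f : MvPolynomial σ k}
    (hf : ∀ t : σ →₀ ℕ, N + 1 ≤ t.degree → coeff t f = 0) (p : MvPolynomial σ k)
    (t : σ →₀ ℕ) (ht : N ≤ t.degree) :
    coeff t (diffOp p f) = constantCoeff p * coeff t f := by
  induction p using MvPolynomial.induction_on generalizing t with
  | C a => simp
  | add p q hp hq => simp only [map_add, LinearMap.add_apply, coeff_add, hp t ht, hq t ht, add_mul]
  | mul_X p i hp =>
    rw [mul_comm, diffOp_mul, diffOp_X, map_mul, constantCoeff_X, zero_mul, zero_mul]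
    refine coeff_pderiv_eq_zero (N := N) (fun u hu => ?_) i t ht
    rw [hp u (by lia), hf u hu, mul_zero]

end DifferentialOperators

section Alternating

variable {k : Type*} [Field k] [CharZero k] {n : ℕ}

theorem coeff_eq_zero_of_alternating {σ : Type*} [DecidableEq σ] {g : MvPolynomial σ k}
    (hg : ∀ i j, i ≠ j → rename (Equiv.swap i j) g = -g) {t : σ →₀ ℕ}
    (ht : ¬ Function.Injective t) : coeff t g = 0 := by
  simp only [Function.Injective, not_forall] at ht
  obtain ⟨i, j, hij, hne⟩ := ht
  have h := coeff_rename_mapDomain (Equiv.swap i j) (Equiv.swap i j).injective g t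
  have htt : t.mapDomain (Equiv.swap i j) = t := by
    ext l
    rw [← Finsupp.equivMapDomain_eq_mapDomain, Finsupp.equivMapDomain_apply, Equiv.symm_swap,
      Equiv.swap_apply_def]
    split_ifs with h₁ h₂
    · rw [h₁, hij]
    · rw [h₂, hij]
    · rfl
  rw [htt, hg i j hne, coeff_neg] at h
  exact self_eq_neg.mp h.symm

theorem sum_range_le_degree {t : Fin n →₀ ℕ} (ht : Function.Injective t) :
    ∑ i ∈ Finset.range n, i ≤ t.degree := by
  have hinj : Function.Injective fun i => (t i : ℤ) := Nat.cast_injective.comp ht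
  have h := Finset.sum_range_le_sum (s := Finset.univ.image fun i => (t i : ℤ)) (c := 0)
    (by simp)
  rw [Finset.card_image_of_injective _ hinj, Finset.sum_image hinj.injOn] at h
  rw [Finsupp.degree_eq_sum]
  simp only [Finset.card_univ, Fintype.card_fin, zero_add] at h
  rw [← Nat.cast_le (α := ℤ), Nat.cast_sum, Nat.cast_sum]
  exact h

theorem eq_zero_of_alternating {g : MvPolynomial (Fin n) k}
    (hg : ∀ i j, i ≠ j → rename (Equiv.swap i j) g = -g)
    (hdeg : ∀ t : Fin n →₀ ℕ, ∑ i ∈ Finset.range n, i ≤ t.degree → coeff t g = 0) : g = 0 := by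
  ext t
  by_cases ht : Function.Injective t
  · exact hdeg t (sum_range_le_degree ht)
  · exact coeff_eq_zero_of_alternating hg ht

end Alternating

section Vandermonde

variable (k : Type*) [Field k] (n : ℕ)

/-- The Vandermonde determinant in the variables of `k[X_0, …, X_{n-1}]`. -/
noncomputable def vandermondeDet : MvPolynomial (Fin n) k :=
  (Matrix.vandermonde fun i : Fin n => (X i : MvPolynomial (Fin n) k)).det

theorem rename_swap_vandermondeDet {i j : Fin n} (hij : i ≠ j) :
    rename (Equiv.swap i j) (vandermondeDet k n) = -vandermondeDet k n := by
  have h := Matrix.det_permute (Equiv.swap i j)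
    (Matrix.vandermonde fun i : Fin n => (X i : MvPolynomial (Fin n) k))
  rw [Equiv.Perm.sign_swap hij] at h
  simp only [Units.val_neg, Units.val_one, Int.cast_neg, Int.cast_one, neg_one_mul] at h
  rw [vandermondeDet, ← h, AlgHom.map_det]
  congr 1
  ext1 a b
  simp [Matrix.vandermonde_apply]

theorem coeff_vandermondeDet_eq_zero (t : Fin n →₀ ℕ)
    (ht : ∑ i ∈ Finset.range n, i + 1 ≤ t.degree) : coeff t (vandermondeDet k n) = 0 := by
  have h : (vandermondeDet k n).IsHomogeneous (∑ i ∈ Finset.range n, i) := by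
    rw [vandermondeDet, Matrix.det_apply]
    refine IsHomogeneous.sum _ _ _ fun e _ => ?_
    have hh : (∏ i, Matrix.vandermonde (fun i : Fin n => (X i : MvPolynomial (Fin n) k)) (e i) i
        ).IsHomogeneous (∑ i : Fin n, (i : ℕ)) := by
      refine IsHomogeneous.prod _ _ _ fun i _ => ?_
      rw [Matrix.vandermonde_apply]
      simpa using (isHomogeneous_X k (e i)).pow (i : ℕ)
    rw [Fin.sum_univ_eq_sum_range fun i => i] at hh
    rcases Int.units_eq_one_or (Equiv.Perm.sign e) with hs | hs
    · simpa [hs] using hh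
    · simpa [hs] using hh.neg
  exact h.coeff_eq_zero (by lia)

variable {k n}

theorem diffOp_vandermondeDet_eq_zero [CharZero k] {s : MvPolynomial (Fin n) k}
    (hs : s.IsSymmetric) (hs₀ : constantCoeff s = 0) : diffOp s (vandermondeDet k n) = 0 := by
  refine eq_zero_of_alternating (fun i j hij => ?_) fun t ht => ?_
  · rw [rename_diffOp, hs, rename_swap_vandermondeDet k n hij, map_neg]
  · rw [coeff_diffOp_eq (coeff_vandermondeDet_eq_zero k n) s t ht, hs₀, zero_mul]

theorem diffOp_vandermondeDet_eq_zero_of_mem [CharZero k] {p : MvPolynomial (Fin n) k}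
    (hp : p ∈ Ideal.span {p : MvPolynomial (Fin n) k | p.IsSymmetric ∧ constantCoeff p = 0}) :
    diffOp p (vandermondeDet k n) = 0 := by
  induction hp using Submodule.span_induction with
  | mem s hs => exact diffOp_vandermondeDet_eq_zero hs.1 hs.2
  | zero => simp
  | add p q _ _ hp hq => rw [map_add, LinearMap.add_apply, hp, hq, add_zero]
  | smul a p _ hp => rw [smul_eq_mul, diffOp_mul, hp, map_zero]

end Vandermonde

end MvPolynomial

section Derivation

variable {R A : Type*} [CommRing R] [CommRing A] [Algebra R A] (D : Derivation R A A)

theorem Derivation.iterate_mul_of_apply_eq_zero {g : A} (hg : D g = 0) (f : A) (m : ℕ) :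
    D^[m] (f * g) = D^[m] f * g := by
  induction m generalizing f with
  | zero => rfl
  | succ m ih =>
    rw [Function.iterate_succ_apply, Function.iterate_succ_apply, D.leibniz, hg,
      smul_zero, zero_add, smul_eq_mul, mul_comm, ih]

theorem Derivation.iterate_succ_mul_of_apply_eq_neg_one {f : A} (hf : D f = -1) (g : A) (m : ℕ) :
    D^[m + 1] (f * g) = f * D^[m + 1] g - (m + 1) * D^[m] g := by
  induction m with
  | zero => simp [hf]; ring
  | succ m ih =>
    rw [Function.iterate_succ_apply', ih, map_sub, D.leibniz, hf, D.leibniz,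
      ← Function.iterate_succ_apply' (f := D), ← Function.iterate_succ_apply' (f := D)]
    have : D ((m : A) + 1) = 0 := by simp
    rw [this]
    push_cast
    simp only [smul_eq_mul]
    ring

theorem Derivation.iterate_card_prod {ι : Type*} (s : Finset ι) (f : ι → A)
    (hf : ∀ i ∈ s, D (f i) = -1) :
    D^[s.card] (∏ i ∈ s, f i) = (-1) ^ s.card * (s.card.factorial : A) := by
  classical
  induction s using Finset.induction_on with
  | empty => simp
  | insert a s ha ih =>
    have ih := ih fun i hi => hf i (Finset.mem_insert_of_mem hi)
    rw [Finset.prod_insert ha, Finset.card_insert_of_notMem ha,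
      D.iterate_succ_mul_of_apply_eq_neg_one (hf a (Finset.mem_insert_self a s)),
      Function.iterate_succ_apply', ih, Nat.factorial_succ]
    have : D ((-1) ^ s.card * (s.card.factorial : A)) = 0 := by simp
    rw [this]
    push_cast
    ring

theorem Derivation.prod_apply_eq_zero {ι : Type*} (s : Finset ι) (f : ι → A)
    (hf : ∀ i ∈ s, D (f i) = 0) : D (∏ i ∈ s, f i) = 0 :=
  Finset.prod_induction f (fun a => D a = 0)
    (fun a b ha hb => by simp [D.leibniz, ha, hb]) (by simp) hf

end Derivation

theorem Fin.card_filter_lt_and_le {ℓ lam : ℕ} (h : lam ≤ ℓ) :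
    (Finset.univ.filter fun x : Fin ℓ × Fin ℓ => (x.1 : ℕ) < lam ∧ lam ≤ (x.2 : ℕ)).card =
      lam * (ℓ - lam) := by
  rw [← Finset.univ_product_univ, Finset.filter_product (fun i : Fin ℓ => (i : ℕ) < lam)
    (fun i : Fin ℓ => lam ≤ (i : ℕ)), Finset.card_product]
  have h₁ : (Finset.univ.filter fun i : Fin ℓ => (i : ℕ) < lam).card = lam := by
    rw [Fin.card_filter_val_lt, min_eq_right h]
  have h₂ := Finset.card_filter_add_card_filter_not (s := Finset.univ)
    (fun i : Fin ℓ => (i : ℕ) < lam)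
  simp only [not_lt, Finset.card_univ, Fintype.card_fin] at h₂
  rw [h₁] at h₂ ⊢
  congr 1
  lia

/-- Let `k` be a field of characteristic zero, `ℓ ≥ 1`, and `1 ≤ λ ≤ ℓ`.
Then `(z_1 + ⋯ + z_λ)^(λ(ℓ-λ))` does not belong to the ideal `I_S` of `k[z_1,…,z_ℓ]`
generated by all symmetric polynomials with zero constant term. -/
theorem sum_pow_not_mem_symmetric_ideal
    (k : Type*) [Field k] [CharZero k] (ℓ lam : ℕ) (hℓ : 1 ≤ ℓ)
    (hlam₁ : 1 ≤ lam) (hlam₂ : lam ≤ ℓ) :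
    (∑ i ∈ Finset.univ.filter (fun i : Fin ℓ => (i : ℕ) < lam), X i) ^ (lam * (ℓ - lam)) ∉
      Ideal.span {p : MvPolynomial (Fin ℓ) k | p.IsSymmetric ∧ constantCoeff p = 0} := by
  intro hmem
  have hzero := diffOp_vandermondeDet_eq_zero_of_mem hmem
  let D : Derivation k (MvPolynomial (Fin ℓ) k) (MvPolynomial (Fin ℓ) k) :=
    ∑ i ∈ Finset.univ.filter (fun i : Fin ℓ => (i : ℕ) < lam), pderiv i
  have hD (f : MvPolynomial (Fin ℓ) k) :
      D f = ∑ i ∈ Finset.univ.filter (fun i : Fin ℓ => (i : ℕ) < lam), pderiv i f := by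
    simp only [D, ← Derivation.coeFnAddMonoidHom_apply, map_sum, Finset.sum_apply]
  have hDX (j : Fin ℓ) : D (X j) = if (j : ℕ) < lam then 1 else 0 := by
    simp [hD, pderiv_X, Pi.single_apply]
  have hop : ⇑(diffOp (∑ i ∈ Finset.univ.filter (fun i : Fin ℓ => (i : ℕ) < lam),
      (X i : MvPolynomial (Fin ℓ) k))) = D := by
    funext f
    simp [hD, diffOp_X, LinearMap.sum_apply]
  rw [map_pow, Module.End.pow_apply, hop, vandermondeDet, Matrix.det_vandermonde,
    Finset.prod_sigma'] at hzero
  set P : Finset (Σ _ : Fin ℓ, Fin ℓ) := Finset.univ.sigma fun i => Finset.Ioi i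
  let crossing (x : Σ _ : Fin ℓ, Fin ℓ) : Prop := (x.1 : ℕ) < lam ∧ lam ≤ (x.2 : ℕ)
  have hcard : (P.filter crossing).card = lam * (ℓ - lam) := by
    rw [← Fin.card_filter_lt_and_le hlam₂]
    refine Finset.card_equiv (Equiv.sigmaEquivProd _ _) fun x => ?_
    simp only [P, crossing, Finset.mem_filter, Finset.mem_sigma, Finset.mem_univ, true_and,
      Finset.mem_Ioi, Equiv.sigmaEquivProd_apply, and_iff_right_iff_imp, Fin.lt_def]
    lia
  rw [← Finset.prod_filter_mul_prod_filter_not P crossing,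
    D.iterate_mul_of_apply_eq_zero, ← hcard, D.iterate_card_prod] at hzero
  · refine mul_ne_zero (mul_ne_zero (by simp) ?_) (Finset.prod_ne_zero_iff.mpr ?_) hzero
    · exact_mod_cast Nat.factorial_ne_zero _
    · intro x hx
      simp only [P, Finset.mem_filter, Finset.mem_sigma, Finset.mem_Ioi] at hx
      exact sub_ne_zero.mpr fun h => hx.1.2.ne' (X_injective h)
  · intro x hx
    have hx := (Finset.mem_filter.mp hx).2
    rw [map_sub, hDX, hDX, if_pos hx.1, if_neg (not_lt.mpr hx.2), zero_sub]
  · refine D.prod_apply_eq_zero _ _ fun x hx => ?_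
    simp only [P, crossing, Finset.mem_filter, Finset.mem_sigma, Finset.mem_Ioi,
      Fin.lt_def] at hx
    rw [map_sub, hDX, hDX, sub_eq_zero]
    congr 1
    simp only [eq_iff_iff]
    lia
end

section
/- Let p ∈ k[z_1,…,z_ℓ] be a λ-symmetric polynomial belonging to I_S. Then there exist λ-symmetric polynomials a_1,…,a_ℓ ∈ k[z_1,…,z_ℓ] such that p = a_1·σ_1(z_1,…,z_ℓ) + a_2·σ_2(z_1,…,z_ℓ) + ⋯ + a_ℓ·σ_ℓ(z_1,…,z_ℓ), where σ_d denotes the elementary symmetric polynomial of degree d. -/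
namespace MvPolynomial

variable {σ R : Type*} [Fintype σ]

/-- The ideal generated by the symmetric polynomials with zero constant term is contained in the
ideal generated by the elementary symmetric polynomials of positive degree. -/
theorem span_isSymmetric_le_span_esymm [CommRing R] {n : ℕ} (hn : Fintype.card σ = n) :
    Ideal.span {q : MvPolynomial σ R | q.IsSymmetric ∧ constantCoeff q = 0} ≤
      Ideal.span (Set.range fun j : Fin n ↦ esymm σ R ((j : ℕ) + 1)) := by
  rw [Ideal.span_le]
  rintro q ⟨hq, hq0⟩
  obtain ⟨f, hf⟩ := esymmAlgHom_surjective R hn.le ⟨q, hq⟩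
  have hqf : aeval (fun j : Fin n ↦ esymm σ R ((j : ℕ) + 1)) f = q := by
    rw [← esymmAlgHom_apply, hf]
  have hesymm (j : Fin n) : constantCoeff (esymm σ R ((j : ℕ) + 1)) = 0 := by
    rw [esymm, map_sum]
    refine Finset.sum_eq_zero fun t ht ↦ ?_
    simp [map_prod, (Finset.mem_powersetCard.mp ht).2]
  have hf0 : constantCoeff f = 0 := by
    rw [← hq0, ← hqf, aeval_def, ← coe_eval₂Hom, ← RingHom.comp_apply]
    congr 1
    ext j
    · simp
    · simp [hesymm]
  have hmem : f ∈ Ideal.span (Set.range (X : Fin n → MvPolynomial (Fin n) R)) := by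
    rw [← Set.image_univ, mem_ideal_span_X_image]
    intro m hm
    by_contra! h
    obtain rfl : m = 0 := Finsupp.ext fun i ↦ h i (Set.mem_univ i)
    exact mem_support_iff.mp hm hf0
  have := Ideal.mem_map_of_mem (aeval fun j : Fin n ↦ esymm σ R ((j : ℕ) + 1)) hmem
  rw [Ideal.map_span, ← Set.range_comp, hqf] at this
  simpa [Function.comp_def] using this

/-- Averaging over a subgroup `G` of permutations of the variables: a `G`-invariant combination of
symmetric polynomials has a representation with `G`-invariant coefficients. -/
theorem exists_invariant_coeff_of_eq_sum [Field R] [CharZero R] {ι : Type*} [Fintype ι]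
    (G : Subgroup (Equiv.Perm σ)) {p : MvPolynomial σ R} (hp : ∀ g ∈ G, rename g p = p)
    {s : ι → MvPolynomial σ R} (hs : ∀ j, (s j).IsSymmetric)
    {c : ι → MvPolynomial σ R} (hc : p = ∑ j, c j * s j) :
    ∃ a : ι → MvPolynomial σ R, (∀ j, ∀ g ∈ G, rename g (a j) = a j) ∧ p = ∑ j, a j * s j := by
  classical
  have : Fintype G := Fintype.ofFinite G
  refine ⟨fun j ↦ C (Fintype.card G : R)⁻¹ * ∑ g : G, rename g.1 (c j), fun j g hg ↦ ?_, ?_⟩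
  · rw [map_mul, rename_C, map_sum]
    congr 1
    refine Fintype.sum_equiv (Equiv.mulLeft (⟨g, hg⟩ : G)) _ _ fun h ↦ ?_
    simp [rename_rename, Equiv.Perm.coe_mul]
  · have hg (g : G) : p = ∑ j, rename g.1 (c j) * s j := by
      conv_lhs => rw [← hp g.1 g.2, hc]
      simp [fun j ↦ hs j g.1]
    have hsum : (Fintype.card G : MvPolynomial σ R) * p =
        ∑ j, (∑ g : G, rename g.1 (c j)) * s j := by
      simp_rw [Finset.sum_mul]
      rw [Finset.sum_comm, ← Finset.sum_congr rfl fun g _ ↦ hg g]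
      simp
    simp_rw [mul_assoc]
    rw [← Finset.mul_sum, ← hsum, ← mul_assoc, ← map_natCast (C (σ := σ) (R := R)), ← C_mul,
      inv_mul_cancel₀ (Nat.cast_ne_zero.mpr Fintype.card_ne_zero), C_1, one_mul]

end MvPolynomial

open MvPolynomial

/-- Variables `z_1,…,z_ℓ` are indexed by `Σ i : Fin n, Fin (λ i)`
(so `ℓ = λ_1 + ⋯ + λ_n`, and the `i`-th block consists of the variables with first
component `i`).  A polynomial is λ-symmetric iff it is invariant under all permutations
of the variables preserving each block.  If a λ-symmetric polynomial `p` lies in the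
ideal `I_S` generated by all symmetric polynomials with zero constant term, then
`p = a_1 σ_1 + ⋯ + a_ℓ σ_ℓ` with all `a_j` λ-symmetric, where `σ_j` is the elementary
symmetric polynomial of degree `j` in all `ℓ` variables. -/
theorem lam_symmetric_mem_span_esymm
    (k : Type*) [Field k] [CharZero k] {n : ℕ} (lam : Fin n → ℕ)
    (p : MvPolynomial (Σ i : Fin n, Fin (lam i)) k)
    (hp : ∀ σ : Equiv.Perm (Σ i : Fin n, Fin (lam i)),
      (∀ x, (σ x).1 = x.1) → rename σ p = p)
    (hmem : p ∈ Ideal.span {q : MvPolynomial (Σ i : Fin n, Fin (lam i)) k |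
      q.IsSymmetric ∧ constantCoeff q = 0}) :
    ∃ a : Fin (∑ i, lam i) → MvPolynomial (Σ i : Fin n, Fin (lam i)) k,
      (∀ j, ∀ σ : Equiv.Perm (Σ i : Fin n, Fin (lam i)),
        (∀ x, (σ x).1 = x.1) → rename σ (a j) = a j) ∧
      p = ∑ j : Fin (∑ i, lam i),
        a j * esymm (Σ i : Fin n, Fin (lam i)) k ((j : ℕ) + 1) := by
  obtain ⟨c, hc⟩ := (Ideal.mem_span_range_iff_exists_fun).mp
    (span_isSymmetric_le_span_esymm (n := ∑ i, lam i) (by simp) hmem)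
  let G : Subgroup (Equiv.Perm (Σ i : Fin n, Fin (lam i))) :=
    { carrier := {σ | ∀ x, (σ x).1 = x.1}
      mul_mem' := fun {σ τ} hσ hτ x ↦ (hσ (τ x)).trans (hτ x)
      one_mem' := fun _ ↦ rfl
      inv_mem' := fun {σ} hσ x ↦ by simpa using (hσ (σ⁻¹ x)).symm }
  exact exists_invariant_coeff_of_eq_sum G hp (fun _ ↦ esymm_isSymmetric _ _ _) hc.symm
end

section
/- For all ℓ ∈ ℤ_{>0} and λ = (λ_1,…,λ_n) ∈ ℤ_{≥0}^n with λ_1+⋯+λ_n = ℓ, the k-algebra A_λ(k) is a finite-dimensional k-vector space of dimension ℓ!/(λ_1!·λ_2!⋯λ_n!). -/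
open MvPolynomial
open scoped Pointwise

universe u

/-- If a monic polynomial over `K` of degree at most `m` splits over `L` with roots `x` and
these generate `L` as a `K`-algebra, then `L` is spanned over `K` by `m!` elements. -/
theorem exists_card_le_factorial_span_eq_top (m : ℕ) :
    ∀ (K L : Type u) [CommRing K] [CommRing L] [Algebra K L] (x : Fin m → L) (f : Polynomial K),
      f.Monic → f.natDegree ≤ m →
      f.map (algebraMap K L) = ∏ i, (Polynomial.X - Polynomial.C (x i)) →
      Algebra.adjoin K (Set.range x) = ⊤ →
      ∃ t : Finset L, t.card ≤ m.factorial ∧ Submodule.span K (t : Set L) = ⊤ := by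
  classical
  induction m with
  | zero =>
    intro K L _ _ _ x f _ _ _ hx
    refine ⟨{1}, by simp, ?_⟩
    rw [Set.range_eq_empty, Algebra.adjoin_empty] at hx
    rw [← Algebra.top_toSubmodule, ← hx, Algebra.toSubmodule_bot, Submodule.one_eq_span]
    simp
  | succ m ih =>
    intro K L _ _ _ x f hf hdeg hfx hx
    rcases subsingleton_or_nontrivial L with hL | hL
    · exact ⟨∅, by simp, Subsingleton.elim _ _⟩
    set K' := Algebra.adjoin K {x 0}
    let a : K' := ⟨x 0, Algebra.self_mem_adjoin_singleton K (x 0)⟩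
    let f' : Polynomial K' := f.map (algebraMap K K')
    have hf' : f'.Monic := hf.map _
    have hmap : f'.map (algebraMap K' L) = ∏ i, (Polynomial.X - Polynomial.C (x i)) := by
      rw [Polynomial.map_map, ← IsScalarTower.algebraMap_eq, hfx]
    have hroot' : Polynomial.aeval (x 0) f = 0 := by
      rw [Polynomial.aeval_def, ← Polynomial.eval_map, hfx, Polynomial.eval_prod]
      exact Finset.prod_eq_zero (Finset.mem_univ 0) (by simp)
    have hroot : f'.IsRoot a := by
      apply (FaithfulSMul.algebraMap_injective K' L)
      rw [← Polynomial.eval_map_apply, hmap, Polynomial.eval_prod, map_zero]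
      exact Finset.prod_eq_zero (Finset.mem_univ 0) (by simp [a])
    have hmul := Polynomial.mul_divByMonic_eq_iff_isRoot.2 hroot
    have hg : (f' /ₘ (Polynomial.X - Polynomial.C a)).Monic :=
      (Polynomial.monic_X_sub_C a).of_mul_monic_left (by rwa [hmul])
    obtain ⟨t, ht, hspan⟩ := ih K' L (fun i => x i.succ) (f' /ₘ (Polynomial.X - Polynomial.C a)) hg
      (by
        rw [Polynomial.natDegree_divByMonic _ (Polynomial.monic_X_sub_C a),
          Polynomial.natDegree_X_sub_C, hf.natDegree_map]
        omega)
      (by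
        apply (Polynomial.monic_X_sub_C (x 0)).isRegular.left
        change _ * _ = _ * _
        rw [← Fin.prod_univ_succ (fun i => Polynomial.X - Polynomial.C (x i)), ← hmap]
        conv_rhs => rw [← hmul]
        simp [a])
      (by
        apply Subalgebra.restrictScalars_injective K
        rw [← Algebra.adjoin_union_eq_adjoin_adjoin, Subalgebra.restrictScalars_top, ← hx]
        congr 1
        ext y
        simp [Fin.exists_fin_succ, eq_comm])
    let s : Finset K' := (Finset.range f.natDegree).image (a ^ ·)
    have hs : Submodule.span K (s : Set K') = ⊤ := by
      apply Submodule.map_injective_of_injective (f := K'.val.toLinearMap) Subtype.val_injective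
      have h := Submodule.span_range_natDegree_eq_adjoin hf hroot'
      rw [Submodule.map_span, Submodule.map_top]
      convert h using 2
      · ext; simp [s, a]
      · ext; simp [K']
    refine ⟨s • t, ?_, ?_⟩
    · calc (s • t).card ≤ s.card * t.card := Finset.card_smul_le
        _ ≤ (m + 1) * m.factorial := by
          gcongr
          exact (Finset.card_image_le.trans_eq (Finset.card_range _)).trans hdeg
    · rw [Finset.coe_smul, Submodule.span_smul_of_span_eq_top hs, hspan,
        Submodule.restrictScalars_top]

namespace MvPolynomial

variable {σ : Type} {k : Type u} [Field k]

variable (σ k) in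
/-- The ideal generated by the symmetric polynomials with zero constant term. -/
noncomputable def coinvariantIdeal : Ideal (MvPolynomial σ k) :=
  Ideal.span {q | q.IsSymmetric ∧ constantCoeff q = 0}

theorem mk_coinvariantIdeal_of_isSymmetric {q : MvPolynomial σ k} (hq : q.IsSymmetric) :
    Ideal.Quotient.mk (coinvariantIdeal σ k) q = algebraMap k _ (constantCoeff q) := by
  rw [← Ideal.Quotient.mk_algebraMap, Ideal.Quotient.mk_eq_mk_iff_sub_mem]
  refine Ideal.subset_span ⟨fun τ => ?_, ?_⟩
  · rw [map_sub, hq τ, algebraMap_eq, rename_C]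
  · rw [map_sub, algebraMap_eq, constantCoeff_C, sub_self]

theorem map_mk_prod_X_sub_C [Fintype σ] :
    (Polynomial.X ^ Fintype.card σ : Polynomial k).map
        (algebraMap k (MvPolynomial σ k ⧸ coinvariantIdeal σ k)) =
      ∏ i, (Polynomial.X - Polynomial.C (Ideal.Quotient.mk (coinvariantIdeal σ k) (X i))) := by
  set Q : Polynomial (MvPolynomial σ k) := ∏ i, (Polynomial.X - Polynomial.C (X i)) with hQ
  have hsymm (j : ℕ) : (Q.coeff j).IsSymmetric := fun τ => by
    have h : Q.map (rename τ : MvPolynomial σ k →ₐ[k] MvPolynomial σ k).toRingHom = Q := by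
      simp only [hQ, Polynomial.map_prod, Polynomial.map_sub, Polynomial.map_X, Polynomial.map_C,
        AlgHom.toRingHom_eq_coe, RingHom.coe_coe, rename_X]
      exact Equiv.prod_comp τ fun i => Polynomial.X - Polynomial.C (X i : MvPolynomial σ k)
    conv_rhs => rw [← h, Polynomial.coeff_map]
    rfl
  have hconst : Q.map constantCoeff = Polynomial.X ^ Fintype.card σ := by
    simp [hQ, Polynomial.map_prod]
  have hmap : Q.map (Ideal.Quotient.mk (coinvariantIdeal σ k)) =
      ∏ i, (Polynomial.X - Polynomial.C (Ideal.Quotient.mk (coinvariantIdeal σ k) (X i))) := by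
    simp [hQ, Polynomial.map_prod]
  rw [← hmap, ← hconst]
  ext j
  rw [Polynomial.coeff_map, Polynomial.coeff_map, Polynomial.coeff_map,
    mk_coinvariantIdeal_of_isSymmetric (hsymm j)]

theorem exists_card_le_factorial_span_coinvariants [Fintype σ] :
    ∃ t : Finset (MvPolynomial σ k ⧸ coinvariantIdeal σ k),
      t.card ≤ (Fintype.card σ).factorial ∧
        Submodule.span k (t : Set (MvPolynomial σ k ⧸ coinvariantIdeal σ k)) = ⊤ := by
  let e := Fintype.equivFin σ
  refine exists_card_le_factorial_span_eq_top _ k _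
    (fun i => Ideal.Quotient.mk (coinvariantIdeal σ k) (X (e.symm i)))
    (Polynomial.X ^ Fintype.card σ) (Polynomial.monic_X_pow _) (Polynomial.natDegree_X_pow_le _)
    ?_ ?_
  · rw [map_mk_prod_X_sub_C]
    exact (Equiv.prod_comp e.symm fun i =>
      Polynomial.X - Polynomial.C (Ideal.Quotient.mk (coinvariantIdeal σ k) (X i))).symm
  · have hrange : Set.range
        (fun i => Ideal.Quotient.mk (coinvariantIdeal σ k) (X (e.symm i))) =
        Ideal.Quotient.mkₐ k (coinvariantIdeal σ k) '' Set.range X := by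
      rw [← Set.range_comp]
      exact e.symm.surjective.range_comp fun i => Ideal.Quotient.mk (coinvariantIdeal σ k) (X i)
    rw [hrange, ← AlgHom.map_adjoin, adjoin_range_X, Algebra.map_top, AlgHom.range_eq_top]
    exact Ideal.Quotient.mkₐ_surjective _ _

/-- A graded Nakayama lemma: homogeneous elements that generate the image of a projection `ρ`
modulo the coinvariant ideal still generate it after specializing the symmetric polynomials to
scalars. -/
theorem map_mem_span_of_mk_mem_span {ι V : Type*} [CommRing V] [Algebra k V]
    (ρ : MvPolynomial σ k →ₗ[k] MvPolynomial σ k)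
    (hρmul : ∀ q s, s.IsSymmetric → ρ (q * s) = ρ q * s)
    (hρhom : ∀ q n, q.IsHomogeneous n → (ρ q).IsHomogeneous n)
    (hρρ : ∀ q, ρ (ρ q) = ρ q)
    (E : MvPolynomial σ k →ₐ[k] V)
    (hE : ∀ s : MvPolynomial σ k, s.IsSymmetric → ∃ c : k, E s = algebraMap k V c)
    (v : ι → MvPolynomial σ k) (hv : ∀ i, ∃ d, (v i).IsHomogeneous d) (hρv : ∀ i, ρ (v i) = v i)
    (hgen : ∀ p, Ideal.Quotient.mkₐ k (coinvariantIdeal σ k) (ρ p) ∈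
      Submodule.span k (Set.range fun i => Ideal.Quotient.mkₐ k (coinvariantIdeal σ k) (v i)))
    (p : MvPolynomial σ k) :
    E (ρ p) ∈ Submodule.span k (Set.range fun i => E (v i)) := by
  set U := Submodule.span k (Set.range fun i => E (v i))
  suffices h : ∀ n (p : MvPolynomial σ k), p.IsHomogeneous n → E (ρ p) ∈ U by
    rw [← sum_homogeneousComponent p, map_sum, map_sum]
    exact Submodule.sum_mem _ fun i _ => h i _ (homogeneousComponent_isHomogeneous i p)
  intro n
  induction n using Nat.strong_induction_on with
  | _ n ih =>
  intro p hp
  have hI : ∀ g ∈ coinvariantIdeal σ k, ∀ q, E (ρ (homogeneousComponent n (q * g))) ∈ U := by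
    intro g hg
    induction hg using Submodule.span_induction with
    | zero => simp
    | add x y _ _ hx hy =>
      intro q
      rw [mul_add, map_add, map_add, map_add]
      exact add_mem (hx q) (hy q)
    | smul r x _ hx =>
      intro q
      rw [smul_eq_mul, ← mul_assoc]
      exact hx _
    | mem s hs =>
      intro q
      rw [← sum_homogeneousComponent q, ← sum_homogeneousComponent s, Finset.sum_mul_sum]
      simp only [map_sum]
      refine Submodule.sum_mem _ fun i _ => Submodule.sum_mem _ fun j _ => ?_
      have hij := (homogeneousComponent_isHomogeneous i q).mul
        (homogeneousComponent_isHomogeneous j s)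
      rw [homogeneousComponent_of_mem hij]
      split_ifs with hn
      · rcases Nat.eq_zero_or_pos j with rfl | hj
        · have : homogeneousComponent 0 s = 0 := by
            rw [homogeneousComponent_zero, ← constantCoeff_eq, hs.2, C_0]
          simp [this]
        · have hsj : (homogeneousComponent j s).IsSymmetric := fun τ => by
            rw [rename_homogeneousComponent, hs.1 τ]
          obtain ⟨c, hc⟩ := hE _ hsj
          rw [hρmul _ _ hsj, map_mul, hc, mul_comm, ← Algebra.smul_def]
          exact U.smul_mem c (ih i (by omega) _ (homogeneousComponent_isHomogeneous i q))
      · simp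
  have hV : ∀ y ∈ Submodule.span k (Set.range v), E (ρ (homogeneousComponent n y)) ∈ U := by
    intro y hy
    induction hy using Submodule.span_induction with
    | zero => simp
    | add x y _ _ hx hy =>
      rw [map_add, map_add, map_add]
      exact add_mem hx hy
    | smul r x _ hx =>
      rw [map_smul, map_smul, map_smul]
      exact U.smul_mem r hx
    | mem y hy =>
      obtain ⟨i, rfl⟩ := hy
      obtain ⟨d, hd⟩ := hv i
      rw [homogeneousComponent_of_mem hd]
      split_ifs
      · rw [hρv]
        exact Submodule.subset_span ⟨i, rfl⟩
      · simp
  have hspan : Submodule.span k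
      (Set.range fun i => Ideal.Quotient.mkₐ k (coinvariantIdeal σ k) (v i)) =
      (Submodule.span k (Set.range v)).map
        (Ideal.Quotient.mkₐ k (coinvariantIdeal σ k)).toLinearMap := by
    rw [Submodule.map_span, ← Set.range_comp]
    rfl
  obtain ⟨y, hy, hyp⟩ := hspan ▸ hgen p
  have hg : ρ p - y ∈ coinvariantIdeal σ k :=
    (Ideal.Quotient.mk_eq_mk_iff_sub_mem _ _).1 hyp.symm
  have hsum := add_mem (hV y hy) (hI _ hg 1)
  rwa [one_mul, ← map_add, ← map_add, ← map_add, add_sub_cancel,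
    homogeneousComponent_eq_self (hρhom p n hp), hρρ] at hsum

/-- Evaluation at all the points of the orbit of `a` under permutations of the coordinates. -/
noncomputable def evalOrbit (a : σ → k) : MvPolynomial σ k →ₐ[k] (Equiv.Perm σ → k) :=
  AlgHom.pi fun w => aeval (a ∘ w)

theorem evalOrbit_apply (a : σ → k) (p : MvPolynomial σ k) (w : Equiv.Perm σ) :
    evalOrbit a p w = eval (a ∘ w) p := by
  simp [evalOrbit, aeval_eq_eval]

theorem evalOrbit_rename (a : σ → k) (p : MvPolynomial σ k) (τ w : Equiv.Perm σ) :
    evalOrbit a (rename τ p) w = evalOrbit a p (w * τ) := by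
  rw [evalOrbit_apply, evalOrbit_apply, eval_rename]
  rfl

theorem evalOrbit_of_isSymmetric (a : σ → k) {s : MvPolynomial σ k} (hs : s.IsSymmetric) :
    evalOrbit a s = algebraMap k _ (eval a s) := by
  ext w
  rw [evalOrbit_apply, ← eval_rename, hs w]
  rfl

theorem evalOrbit_surjective [Finite σ] {a : σ → k} (ha : Function.Injective a) :
    Function.Surjective (evalOrbit a) := by
  classical
  have := Fintype.ofFinite σ
  rw [← AlgHom.coe_toLinearMap, ← LinearMap.range_eq_top, eq_top_iff,
    ← (Pi.basisFun k (Equiv.Perm σ)).span_eq, Submodule.span_le]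
  rintro _ ⟨w, rfl⟩
  have hne (w' : {w' // w' ≠ w}) : ∃ i, w'.1 i ≠ w i := DFunLike.ne_iff.1 w'.2
  choose i hi using hne
  let q : MvPolynomial σ k := ∏ w', (X (i w') - C (a (w'.1 (i w'))))
  have hq : eval (a ∘ w) q ≠ 0 := by
    simp only [q, map_prod, map_sub, eval_X, eval_C, Finset.prod_ne_zero_iff]
    exact fun w' _ => sub_ne_zero.2 fun h => hi w' (ha h).symm
  refine ⟨(eval (a ∘ w) q)⁻¹ • q, ?_⟩
  ext w'
  rw [AlgHom.coe_toLinearMap, map_smul, Pi.smul_apply, evalOrbit_apply, Pi.basisFun_apply]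
  rcases eq_or_ne w' w with rfl | h
  · simp [hq]
  · have hq' : eval (a ∘ w') q = 0 := by
      rw [map_prod]
      exact Finset.prod_eq_zero (Finset.mem_univ ⟨w', h⟩) (by simp)
    simp [hq', h]

section Reynolds

variable (H : Subgroup (Equiv.Perm σ)) [Fintype H]

/-- The averaging operator over a group of permutations of the variables. -/
noncomputable def reynolds : MvPolynomial σ k →ₗ[k] MvPolynomial σ k :=
  (Fintype.card H : k)⁻¹ • ∑ τ : H, (rename (τ : Equiv.Perm σ)).toLinearMap

theorem reynolds_apply (p : MvPolynomial σ k) :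
    reynolds H p = (Fintype.card H : k)⁻¹ • ∑ τ : H, rename (τ : Equiv.Perm σ) p := by
  simp [reynolds]

theorem reynolds_mul_of_isSymmetric (q : MvPolynomial σ k) {s : MvPolynomial σ k}
    (hs : s.IsSymmetric) : reynolds H (q * s) = reynolds H q * s := by
  simp only [reynolds_apply, map_mul, hs _, smul_mul_assoc, Finset.sum_mul]

theorem IsHomogeneous.reynolds {q : MvPolynomial σ k} {n : ℕ} (hq : q.IsHomogeneous n) :
    (reynolds H q).IsHomogeneous n := by
  rw [reynolds_apply]
  exact (homogeneousSubmodule σ k n).smul_mem _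
    (Submodule.sum_mem _ fun τ _ => hq.rename_isHomogeneous)

theorem rename_reynolds (q : MvPolynomial σ k) {τ : Equiv.Perm σ} (hτ : τ ∈ H) :
    rename τ (reynolds H q) = reynolds H q := by
  simp only [reynolds_apply, map_smul, map_sum, rename_rename]
  congr 1
  exact Equiv.sum_comp (Equiv.mulLeft (⟨τ, hτ⟩ : H)) fun τ' => rename (τ' : Equiv.Perm σ) q

theorem reynolds_eq_self [CharZero k] {q : MvPolynomial σ k}
    (hq : ∀ τ ∈ H, rename τ q = q) : reynolds H q = q := by
  rw [reynolds_apply, Finset.sum_congr rfl fun τ _ => hq _ τ.property, Finset.sum_const,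
    Finset.card_univ, ← Nat.cast_smul_eq_nsmul k, inv_smul_smul₀]
  exact Nat.cast_ne_zero.2 Fintype.card_ne_zero

theorem evalOrbit_reynolds (a : σ → k) (q : MvPolynomial σ k) (w : Equiv.Perm σ) :
    evalOrbit a (reynolds H q) w =
      (Fintype.card H : k)⁻¹ * ∑ τ : H, evalOrbit a q (w * τ) := by
  simp [reynolds_apply, evalOrbit_rename]

theorem map_evalOrbit_range_reynolds [Finite σ] [CharZero k] {a : σ → k}
    (ha : Function.Injective a) :
    (LinearMap.range (reynolds H)).map (evalOrbit a).toLinearMap =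
      LinearMap.range (LinearMap.funLeft k k (QuotientGroup.mk : _ → Equiv.Perm σ ⧸ H)) := by
  apply le_antisymm
  · rintro _ ⟨_, ⟨q, rfl⟩, rfl⟩
    refine ⟨fun x => Quotient.liftOn' x (evalOrbit a (reynolds H q)) fun w w' h => ?_, ?_⟩
    · rw [QuotientGroup.leftRel_apply] at h
      conv_lhs => rw [← rename_reynolds H q h, evalOrbit_rename, mul_inv_cancel_left]
    · ext w
      rfl
  · rintro _ ⟨f, rfl⟩
    obtain ⟨q, hq⟩ := evalOrbit_surjective ha
      (LinearMap.funLeft k k (QuotientGroup.mk : _ → Equiv.Perm σ ⧸ H) f)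
    refine ⟨_, ⟨q, rfl⟩, ?_⟩
    ext w
    have hH : (Fintype.card H : k) ≠ 0 := Nat.cast_ne_zero.2 Fintype.card_ne_zero
    simp [evalOrbit_reynolds, hq, LinearMap.funLeft_apply, hH]

end Reynolds

variable [Fintype σ]

instance finite_coinvariants : Module.Finite k (MvPolynomial σ k ⧸ coinvariantIdeal σ k) := by
  obtain ⟨t, -, ht⟩ := exists_card_le_factorial_span_coinvariants (σ := σ) (k := k)
  exact ⟨t, ht⟩

theorem finrank_coinvariants_le :
    Module.finrank k (MvPolynomial σ k ⧸ coinvariantIdeal σ k) ≤ (Fintype.card σ).factorial := by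
  obtain ⟨t, htc, ht⟩ := exists_card_le_factorial_span_coinvariants (σ := σ) (k := k)
  rw [← finrank_top, ← ht]
  exact (finrank_span_finset_le_card t).trans htc

/-- The invariants of `H` in the coinvariant algebra have dimension the index of `H`. -/
theorem finrank_map_invariants [CharZero k] (H : Subgroup (Equiv.Perm σ))
    (S : Submodule k (MvPolynomial σ k))
    (hS : ∀ p, p ∈ S ↔ ∀ τ ∈ H, rename τ p = p) :
    Module.finrank k (S.map (Ideal.Quotient.mkₐ k (coinvariantIdeal σ k)).toLinearMap) =
      H.index := by
  classical
  have : Fintype H := Fintype.ofFinite H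
  let π := Ideal.Quotient.mkₐ k (coinvariantIdeal σ k)
  have hS_reynolds : S = LinearMap.range (reynolds H) := by
    ext p
    rw [hS]
    exact ⟨fun h => ⟨p, reynolds_eq_self H h⟩,
      fun ⟨q, hq⟩ τ hτ => hq ▸ rename_reynolds H q hτ⟩
  let a : σ → k := fun i => (Fintype.equivFin σ i : ℕ)
  have ha : Function.Injective a :=
    Nat.cast_injective.comp (Fin.val_injective.comp (Fintype.equivFin σ).injective)
  let homog : Set (MvPolynomial σ k) := {p | ∃ d, p.IsHomogeneous d}
  have mem_span_homog (T : Submodule k (MvPolynomial σ k))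
      (hT : ∀ p ∈ T, ∀ n, homogeneousComponent n p ∈ T) :
      T.map π.toLinearMap ≤ Submodule.span k (π '' (homog ∩ T)) := by
    rintro _ ⟨p, hp, rfl⟩
    rw [← sum_homogeneousComponent p, map_sum]
    exact Submodule.sum_mem _ fun i _ => Submodule.subset_span
      ⟨_, ⟨⟨i, homogeneousComponent_isHomogeneous i p⟩, hT p hp i⟩, rfl⟩
  obtain ⟨s, hsS, hs_span, hs⟩ := exists_linearIndependent k (π '' (homog ∩ S))
  obtain ⟨b, hb_sub, hsb, hb_span, hb⟩ := exists_linearIndepOn_id_extension (K := k)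
    (t := π '' homog) hs (hsS.trans (Set.image_mono Set.inter_subset_left))
  have hlift (c : b) : ∃ p ∈ homog, π p = c ∧ (c.1 ∈ s → p ∈ S) := by
    by_cases hc : c.1 ∈ s
    · obtain ⟨p, hp, hpc⟩ := hsS hc
      exact ⟨p, hp.1, hpc, fun _ => hp.2⟩
    · obtain ⟨p, hp, hpc⟩ := hb_sub c.2
      exact ⟨p, hp, hpc, fun h => (hc h).elim⟩
  choose v hv_homog hπv hvS using hlift
  have hE (q : MvPolynomial σ k) (hq : q.IsSymmetric) :
      ∃ c : k, evalOrbit a q = algebraMap k (Equiv.Perm σ → k) c :=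
    ⟨_, evalOrbit_of_isSymmetric a hq⟩
  have hb_top : Submodule.span k b = ⊤ := by
    refine top_le_iff.1 (le_trans ?_ (Submodule.span_le.2 hb_span))
    refine le_trans ?_ ((mem_span_homog ⊤ fun _ _ _ => trivial).trans
      (Submodule.span_mono (Set.image_mono Set.inter_subset_left)))
    rw [Submodule.map_top]
    exact (LinearMap.range_eq_top.2 (Ideal.Quotient.mkₐ_surjective k _)).ge
  have hv_span : ⊤ ≤ Submodule.span k (Set.range fun c : b => evalOrbit a (v c)) := by
    intro f _
    obtain ⟨p, rfl⟩ := evalOrbit_surjective ha f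
    refine map_mem_span_of_mk_mem_span LinearMap.id (fun _ _ _ => rfl) (fun _ _ h => h)
      (fun _ => rfl) _ hE v hv_homog (fun _ => rfl) (fun p => ?_) p
    have hrange : (Set.range fun c : b => π (v c)) = b := by
      simp_rw [hπv]
      exact Subtype.range_coe
    rw [hrange, hb_top]
    trivial
  have : Fintype b := (LinearIndependent.setFinite hb).fintype
  have hv_indep : LinearIndependent k fun c : b => evalOrbit a (v c) := by
    apply linearIndependent_of_top_le_span_of_card_le_finrank hv_span
    rw [Module.finrank_fintype_fun_eq_card, Fintype.card_perm]
    exact hb.fintype_card_le_finrank.trans finrank_coinvariants_le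
  have : Fintype s := (LinearIndependent.setFinite hs).fintype
  let w (c : s) : MvPolynomial σ k := v ⟨c, hsb c.2⟩
  have hw_indep : LinearIndependent k fun c : s => evalOrbit a (w c) :=
    hv_indep.comp (fun c : s => ⟨c, hsb c.2⟩) fun c d h =>
      Subtype.ext (congrArg (fun x : b => x.1) h)
  have hs_map : S.map π.toLinearMap = Submodule.span k s := by
    rw [hs_span]
    refine le_antisymm (mem_span_homog S fun p hp n => ?_) (Submodule.span_le.2 ?_)
    · rw [hS] at hp ⊢
      exact fun τ hτ => by rw [rename_homogeneousComponent, hp τ hτ]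
    · rintro _ ⟨p, hp, rfl⟩
      exact ⟨p, hp.2, rfl⟩
  have hwS (c : s) : w c ∈ S := hvS _ c.2
  have hw_span : Submodule.span k (Set.range fun c : s => evalOrbit a (w c)) =
      S.map (evalOrbit a).toLinearMap := by
    apply le_antisymm
    · rw [Submodule.span_le]
      rintro _ ⟨c, rfl⟩
      exact ⟨_, hwS c, rfl⟩
    · rw [hS_reynolds]
      rintro _ ⟨_, ⟨p, rfl⟩, rfl⟩
      refine map_mem_span_of_mk_mem_span (reynolds H)
        (fun q s => reynolds_mul_of_isSymmetric H q) (fun q n => IsHomogeneous.reynolds H)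
        (fun q => reynolds_eq_self H fun τ => rename_reynolds H q) _ hE w
        (fun c => hv_homog _) (fun c => reynolds_eq_self H ((hS _).1 (hwS c))) (fun p => ?_) p
      have hrange : (Set.range fun c : s => π (w c)) = s := by
        simp_rw [w, hπv]
        exact Subtype.range_coe
      rw [hrange, ← hs_map, hS_reynolds]
      exact ⟨_, ⟨p, rfl⟩, rfl⟩
  calc Module.finrank k (S.map π.toLinearMap) = Fintype.card s := by
        rw [hs_map, ← Set.toFinset_card]
        exact finrank_span_set_eq_card hs
    _ = Module.finrank k (S.map (evalOrbit a).toLinearMap) := by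
        rw [← hw_span, finrank_span_eq_card hw_indep]
    _ = Module.finrank k (Equiv.Perm σ ⧸ H → k) := by
        rw [hS_reynolds, map_evalOrbit_range_reynolds H ha]
        exact LinearMap.finrank_range_of_inj
          (LinearMap.funLeft_injective_of_surjective k k _ Quotient.mk_surjective)
    _ = H.index := by
        rw [Module.finrank_fintype_fun_eq_card, ← Nat.card_eq_fintype_card]
        rfl

end MvPolynomial

/-- The permutations preserving the blocks of a sigma type. -/
def blockPerms {n : ℕ} (lam : Fin n → ℕ) : Subgroup (Equiv.Perm (Σ i : Fin n, Fin (lam i))) where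
  carrier := {σ | ∀ x, (σ x).1 = x.1}
  mul_mem' {σ τ} hσ hτ x := (hσ (τ x)).trans (hτ x)
  one_mem' _ := rfl
  inv_mem' {σ} hσ x := by simpa using (hσ (σ⁻¹ x)).symm

theorem card_blockPerms {n : ℕ} (lam : Fin n → ℕ) :
    Nat.card (blockPerms lam) = ∏ i, (lam i).factorial := by
  have h := DomMulAct.stabilizer_card (Sigma.fst : (Σ i : Fin n, Fin (lam i)) → Fin n)
  have hfib (i : Fin n) : Fintype.card {a : Σ i : Fin n, Fin (lam i) // a.1 = i} = lam i := by
    rw [Fintype.card_congr (Equiv.sigmaSubtype i)]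
    simp
  simp only [hfib] at h
  rw [← h, ← Nat.card_eq_fintype_card]
  exact Nat.card_congr (Equiv.subtypeEquivRight fun σ => by
    rw [_root_.funext_iff]
    rfl)

theorem index_blockPerms {n : ℕ} (lam : Fin n → ℕ) :
    (blockPerms lam).index = (∑ i, lam i).factorial / ∏ i, (lam i).factorial := by
  rw [← card_blockPerms]
  refine (Nat.div_eq_of_eq_mul_left Nat.card_pos ?_).symm
  rw [Subgroup.index_mul_card, Nat.card_perm]
  simp

/-- The variables `z_1,…,z_ℓ` are indexed by `Σ i : Fin n, Fin (λ i)`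
(so `ℓ = λ_1 + ⋯ + λ_n`).  `A_λ(k)` is the `k`-subalgebra of
`k[z]/I_S` (where `I_S` is the ideal generated by all symmetric polynomials with zero
constant term) consisting of the images of all λ-symmetric polynomials, i.e. of all
polynomials invariant under every block-preserving permutation of the variables.
Then `A_λ(k)` is finite dimensional over `k` of dimension `ℓ! / (λ_1! ⋯ λ_n!)`. -/
theorem finrank_lamSymmetric_subalgebra
    (k : Type*) [Field k] [CharZero k] {n : ℕ} (lam : Fin n → ℕ)
    (IS : Ideal (MvPolynomial (Σ i : Fin n, Fin (lam i)) k))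
    (hIS : IS = Ideal.span {q | q.IsSymmetric ∧ constantCoeff q = 0})
    (S : Subalgebra k (MvPolynomial (Σ i : Fin n, Fin (lam i)) k))
    (hS : S.carrier = {p | ∀ σ : Equiv.Perm (Σ i : Fin n, Fin (lam i)),
      (∀ x, (σ x).1 = x.1) → rename σ p = p})
    (A : Subalgebra k (MvPolynomial (Σ i : Fin n, Fin (lam i)) k ⧸ IS))
    (hA : A = S.map (Ideal.Quotient.mkₐ k IS)) :
    FiniteDimensional k A ∧
      Module.finrank k A = (∑ i, lam i).factorial / ∏ i, (lam i).factorial := by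
  change IS = coinvariantIdeal _ k at hIS
  subst hIS
  refine ⟨FiniteDimensional.finiteDimensional_subalgebra A, ?_⟩
  rw [← index_blockPerms, ← finrank_map_invariants (k := k) (blockPerms lam)
    (Subalgebra.toSubmodule S) fun p => Set.ext_iff.1 hS p, hA]
  rfl
end

section
/- For every field k of characteristic zero and every λ = (λ_1,…,λ_n) ∈ ℤ_{≥0}^n with λ_1+⋯+λ_n = ℓ, the k-algebras A_λ(k) and C_λ(k) are isomorphic. -/
open MvPolynomial

namespace MvPolynomial

section SumVariables

variable (R : Type*) [CommRing R] (m : ℕ) (β : Type*)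

/-- The endomorphism of `R[x_1,…,x_m, (y_b)_b]` fixing the `y_b` and sending the `x_j` to the
elementary symmetric polynomials in `x_1,…,x_m`, by decreasing degree. -/
noncomputable def esymmInlHom : MvPolynomial (Fin m ⊕ β) R →ₐ[R] MvPolynomial (Fin m ⊕ β) R :=
  aeval (Sum.elim (fun j ↦ rename Sum.inl (esymm (Fin m) R (m - j))) (fun b ↦ X (Sum.inr b)))

variable {R m β}

lemma sumAlgEquiv_rename_inl_esymm (d : ℕ) :
    sumAlgEquiv R (Fin m) β (rename Sum.inl (esymm (Fin m) R d)) =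
      esymm (Fin m) (MvPolynomial β R) d := by
  simp [esymm, map_sum, map_prod]

lemma sumAlgEquiv_esymmInlHom (p : MvPolynomial (Fin m ⊕ β) R) :
    sumAlgEquiv R (Fin m) β (esymmInlHom R m β p) =
      (esymmAlgHom (Fin m) (MvPolynomial β R) m
        (renameEquiv (MvPolynomial β R) Fin.revPerm (sumAlgEquiv R (Fin m) β p))).val := by
  induction p using MvPolynomial.induction_on with
  | C r =>
    rw [← algebraMap_eq, AlgHom.commutes, algebraMap_eq, sumAlgEquiv_C_inl, ← algebraMap_eq,
      AlgEquiv.commutes, AlgHom.commutes]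
    rfl
  | add p q hp hq => simp only [map_add, hp, hq]; rfl
  | mul_X p x hp =>
    simp only [map_mul, hp]
    rw [MulMemClass.coe_mul]
    congr 1
    rcases x with j | b
    · have hj : ((Fin.rev j : Fin m) : ℕ) + 1 = m - j := by
        rw [Fin.val_rev]; omega
      simp only [esymmInlHom, aeval_X, Sum.elim_inl, sumAlgEquiv_rename_inl_esymm,
        sumAlgEquiv_X_inl, renameEquiv_apply, rename_X, esymmAlgHom, Fin.revPerm_apply, hj]
    · rw [sumAlgEquiv_X_inr]
      simp only [esymmInlHom, aeval_X, Sum.elim_inr, sumAlgEquiv_X_inr]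
      rw [← algebraMap_eq, AlgEquiv.commutes, AlgHom.commutes]
      rfl

lemma sumAlgEquiv_rename_sumMap (τ : Fin m → Fin m) (p : MvPolynomial (Fin m ⊕ β) R) :
    sumAlgEquiv R (Fin m) β (rename (Sum.map τ id) p) =
      rename τ (sumAlgEquiv R (Fin m) β p) := by
  induction p using MvPolynomial.induction_on with
  | C r => simp
  | add p q hp hq => simp only [map_add, hp, hq]
  | mul_X p x hp => rcases x with j | b <;> simp [hp]

lemma esymmInlHom_injective : Function.Injective (esymmInlHom R m β) := by
  intro p q h
  have h' := congrArg (sumAlgEquiv R (Fin m) β) h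
  rw [sumAlgEquiv_esymmInlHom, sumAlgEquiv_esymmInlHom] at h'
  exact (sumAlgEquiv R (Fin m) β).injective ((renameEquiv _ Fin.revPerm).injective
    ((esymmAlgHom_fin_bijective (MvPolynomial β R) m).1 (Subtype.ext h')))

lemma exists_esymmInlHom_eq {p : MvPolynomial (Fin m ⊕ β) R}
    (hp : ∀ τ : Equiv.Perm (Fin m), rename (Sum.map τ id) p = p) :
    ∃ q, esymmInlHom R m β q = p := by
  have hs : (sumAlgEquiv R (Fin m) β p).IsSymmetric := fun τ ↦ by
    rw [← sumAlgEquiv_rename_sumMap, hp]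
  obtain ⟨r, hr⟩ := (esymmAlgHom_fin_bijective (MvPolynomial β R) m).2 ⟨_, hs⟩
  refine ⟨(sumAlgEquiv R (Fin m) β).symm ((renameEquiv _ Fin.revPerm).symm r), ?_⟩
  apply (sumAlgEquiv R (Fin m) β).injective
  rw [sumAlgEquiv_esymmInlHom, AlgEquiv.apply_symm_apply, AlgEquiv.apply_symm_apply, hr]

end SumVariables

section Blocks

variable {ι : Type*} {R : Type*} [CommRing R] {lam : ι → ℕ}

variable (R) in
/-- The elementary symmetric polynomial of degree `lam i - j` in the variables of the block `i`,
for `x = ⟨i, j⟩`. -/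
noncomputable def blockEsymm (x : Σ i, Fin (lam i)) : MvPolynomial (Σ i, Fin (lam i)) R :=
  rename (Sigma.mk x.1) (esymm (Fin (lam x.1)) R (lam x.1 - x.2))

lemma rename_blockEsymm {σ : Equiv.Perm (Σ i, Fin (lam i))} (hσ : ∀ x, (σ x).1 = x.1)
    (x : Σ i, Fin (lam i)) : rename σ (blockEsymm R x) = blockEsymm R x := by
  obtain ⟨i, j⟩ := x
  have h : ∀ j : Fin (lam i), ∃ j', σ ⟨i, j⟩ = ⟨i, j'⟩ := fun j ↦ by
    have := hσ ⟨i, j⟩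
    generalize σ ⟨i, j⟩ = y at this
    obtain ⟨a, b⟩ := y
    obtain rfl : a = i := this
    exact ⟨b, rfl⟩
  choose τ hτ using h
  have hinj : Function.Injective τ := fun a b hab ↦ by
    have : σ ⟨i, a⟩ = σ ⟨i, b⟩ := by rw [hτ, hτ, hab]
    simpa using this
  have hcomp : σ ∘ Sigma.mk i =
      Sigma.mk i ∘ Equiv.ofBijective τ (Finite.injective_iff_bijective.1 hinj) :=
    _root_.funext hτ
  simp only [blockEsymm]
  rw [rename_rename, hcomp, ← rename_rename, rename_esymm]

lemma sum_blockEsymm_eq_prod (i : ι) :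
    (∑ j : Fin (lam i), Polynomial.C (blockEsymm R (⟨i, j⟩ : Σ i, Fin (lam i))) *
      Polynomial.X ^ (j : ℕ)) + Polynomial.X ^ (lam i) =
    ∏ j : Fin (lam i),
      (Polynomial.X + Polynomial.C (X (⟨i, j⟩ : Σ i, Fin (lam i)) : MvPolynomial _ R)) := by
  have h := congrArg (Polynomial.map
      (rename (R := R) (Sigma.mk (β := fun i ↦ Fin (lam i)) i)).toRingHom)
    (MvPolynomial.prod_C_add_X_eq_sum_esymm R (Fin (lam i)))
  rw [Polynomial.map_prod, Polynomial.map_sum] at h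
  simp only [Polynomial.map_add, Polynomial.map_X, Polynomial.map_C, Polynomial.map_mul,
    Polynomial.map_pow, AlgHom.toRingHom_eq_coe, RingHom.coe_coe, rename_X, Fintype.card_fin] at h
  rw [h, ← Finset.sum_range_reflect, Finset.sum_range_succ, Finset.sum_range]
  congr 1
  · refine Finset.sum_congr rfl fun j _ ↦ ?_
    have h1 : lam i + 1 - 1 - (j : ℕ) = lam i - j := by omega
    have h2 : lam i - (lam i - (j : ℕ)) = j := by omega
    rw [h1, h2]
    rfl
  · simp

variable [DecidableEq ι]

variable (R lam) in
/-- The endomorphism replacing the variables of the blocks in `T` by the elementary symmetric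
polynomials of these blocks. -/
noncomputable def blockHom (T : Finset ι) :
    MvPolynomial (Σ i, Fin (lam i)) R →ₐ[R] MvPolynomial (Σ i, Fin (lam i)) R :=
  aeval fun x ↦ if x.1 ∈ T then blockEsymm R x else X x

lemma blockHom_X_of_mem {T : Finset ι} {x : Σ i, Fin (lam i)} (hx : x.1 ∈ T) :
    blockHom R lam T (X x) = blockEsymm R x := by
  rw [blockHom, aeval_X, if_pos hx]

lemma blockHom_X_of_notMem {T : Finset ι} {x : Σ i, Fin (lam i)} (hx : x.1 ∉ T) :
    blockHom R lam T (X x) = X x := by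
  rw [blockHom, aeval_X, if_neg hx]

variable (lam) in
/-- The decomposition of the variables into those of the block `i` and the other ones. -/
noncomputable def blockSumEquiv (i : ι) :
    Fin (lam i) ⊕ {x : Σ i, Fin (lam i) // x.1 ≠ i} ≃ Σ i, Fin (lam i) :=
  Equiv.ofBijective (Sum.elim (Sigma.mk (β := fun i ↦ Fin (lam i)) i) Subtype.val) <| by
    constructor
    · rintro (a | ⟨a, ha⟩) (b | ⟨b, hb⟩) h
      · simpa using h
      · exact absurd (congrArg Sigma.fst h).symm hb
      · exact absurd (congrArg Sigma.fst h) ha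
      · simpa using h
    · rintro ⟨a, b⟩
      by_cases h : a = i
      · subst h
        exact ⟨Sum.inl b, rfl⟩
      · exact ⟨Sum.inr ⟨⟨a, b⟩, h⟩, rfl⟩

lemma blockSumEquiv_inl (i : ι) (j : Fin (lam i)) :
    blockSumEquiv lam i (Sum.inl j) = ⟨i, j⟩ := rfl

lemma blockSumEquiv_inr (i : ι) (y : {x : Σ i, Fin (lam i) // x.1 ≠ i}) :
    blockSumEquiv lam i (Sum.inr y) = y.1 := rfl

lemma blockHom_singleton_rename (i : ι)
    (p : MvPolynomial (Fin (lam i) ⊕ {x : Σ i, Fin (lam i) // x.1 ≠ i}) R) :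
    blockHom R lam {i} (rename (blockSumEquiv lam i) p) =
      rename (blockSumEquiv lam i) (esymmInlHom R _ _ p) := by
  induction p using MvPolynomial.induction_on with
  | C r => simp [esymmInlHom, blockHom]
  | add p q hp hq => simp only [map_add, hp, hq]
  | mul_X p x hp =>
    simp only [map_mul, hp, rename_X]
    congr 1
    rcases x with j | y
    · rw [blockSumEquiv_inl, blockHom_X_of_mem (by simp), esymmInlHom, aeval_X, Sum.elim_inl,
        rename_rename]
      rfl
    · rw [blockSumEquiv_inr, blockHom_X_of_notMem (by simpa using y.2), esymmInlHom, aeval_X,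
        Sum.elim_inr, rename_X, blockSumEquiv_inr]

lemma blockHom_singleton_injective (i : ι) : Function.Injective (blockHom R lam {i}) := by
  intro p q h
  obtain ⟨p, rfl⟩ := (renameEquiv R (blockSumEquiv lam i)).surjective p
  obtain ⟨q, rfl⟩ := (renameEquiv R (blockSumEquiv lam i)).surjective q
  simp only [renameEquiv_apply, blockHom_singleton_rename] at h ⊢
  rw [esymmInlHom_injective (rename_injective _ (blockSumEquiv lam i).injective h)]

lemma exists_blockHom_singleton_eq (i : ι) {p : MvPolynomial (Σ i, Fin (lam i)) R}
    (hp : ∀ σ : Equiv.Perm (Σ i, Fin (lam i)), (∀ x, (σ x).1 = x.1) →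
      (∀ x, x.1 ≠ i → σ x = x) → rename σ p = p) :
    ∃ q, blockHom R lam {i} q = p := by
  obtain ⟨p, rfl⟩ := (renameEquiv R (blockSumEquiv lam i)).surjective p
  simp only [renameEquiv_apply] at hp ⊢
  obtain ⟨q, rfl⟩ := exists_esymmInlHom_eq (p := p) fun τ ↦ by
    apply rename_injective _ (blockSumEquiv lam i).injective
    have key : ∀ y, ((blockSumEquiv lam i).symm.trans
        ((Equiv.sumCongr τ (Equiv.refl _)).trans (blockSumEquiv lam i))) (blockSumEquiv lam i y) =
          blockSumEquiv lam i (Sum.map τ id y) := fun y ↦ by simp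
    have := hp ((blockSumEquiv lam i).symm.trans
      ((Equiv.sumCongr τ (Equiv.refl _)).trans (blockSumEquiv lam i))) ?_ ?_
    · rw [rename_rename] at this ⊢
      rwa [show _ ∘ _ = _ ∘ Sum.map τ id from _root_.funext key] at this
    · intro x
      obtain ⟨y, rfl⟩ := (blockSumEquiv lam i).surjective x
      rw [key]
      rcases y with j | y <;> rfl
    · intro x hx
      obtain ⟨y, rfl⟩ := (blockSumEquiv lam i).surjective x
      rw [key]
      rcases y with j | y
      · exact absurd rfl hx
      · rfl
  exact ⟨_, blockHom_singleton_rename i q⟩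

lemma blockHom_rename_mk_of_notMem {T : Finset ι} {i : ι} (hi : i ∉ T)
    (p : MvPolynomial (Fin (lam i)) R) :
    blockHom R lam T (rename (Sigma.mk i) p) = rename (Sigma.mk i) p := by
  rw [blockHom, aeval_rename, rename_eq_aeval]
  congr 2
  ext1 j
  exact if_neg hi

lemma blockHom_insert {T : Finset ι} {i : ι} (hi : i ∉ T)
    (p : MvPolynomial (Σ i, Fin (lam i)) R) :
    blockHom R lam (insert i T) p = blockHom R lam T (blockHom R lam {i} p) := by
  rw [← AlgHom.comp_apply]
  congr 1
  ext1 x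
  rw [AlgHom.comp_apply]
  by_cases hx : x.1 = i
  · obtain ⟨a, b⟩ := x
    obtain rfl : a = i := hx
    rw [blockHom_X_of_mem (by simp), blockHom_X_of_mem (by simp), blockEsymm,
      blockHom_rename_mk_of_notMem hi]
  · rw [blockHom_X_of_notMem (T := {i}) (by simpa using hx)]
    by_cases hT : x.1 ∈ T
    · rw [blockHom_X_of_mem hT, blockHom_X_of_mem (by simp [hT])]
    · rw [blockHom_X_of_notMem hT, blockHom_X_of_notMem (by simp [hT, hx])]

lemma blockHom_rename_of_preserves (T : Finset ι) {σ : Equiv.Perm (Σ i, Fin (lam i))}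
    (hσ : ∀ x, (σ x).1 = x.1) (hT : ∀ x, x.1 ∈ T → σ x = x)
    (p : MvPolynomial (Σ i, Fin (lam i)) R) :
    blockHom R lam T (rename σ p) = rename σ (blockHom R lam T p) := by
  rw [← AlgHom.comp_apply, ← AlgHom.comp_apply]
  congr 1
  ext1 x
  rw [AlgHom.comp_apply, AlgHom.comp_apply, rename_X]
  by_cases hx : x.1 ∈ T
  · rw [hT x hx, blockHom_X_of_mem hx, rename_blockEsymm hσ]
  · rw [blockHom_X_of_notMem hx, blockHom_X_of_notMem (by rwa [hσ]), rename_X]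

lemma blockHom_injective (T : Finset ι) : Function.Injective (blockHom R lam T) := by
  induction T using Finset.induction_on with
  | empty =>
    have : blockHom R lam ∅ = AlgHom.id R _ := by
      ext1 x
      exact blockHom_X_of_notMem (by simp)
    rw [this]
    exact Function.injective_id
  | insert i T hi ih =>
    intro p q h
    rw [blockHom_insert hi, blockHom_insert hi] at h
    exact blockHom_singleton_injective i (ih h)

/-- The fundamental theorem on symmetric polynomials, for polynomials symmetric separately in
several blocks of variables. -/
lemma exists_blockHom_eq (T : Finset ι) {p : MvPolynomial (Σ i, Fin (lam i)) R}
    (hp : ∀ σ : Equiv.Perm (Σ i, Fin (lam i)), (∀ x, (σ x).1 = x.1) →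
      (∀ x, x.1 ∉ T → σ x = x) → rename σ p = p) :
    ∃ q, blockHom R lam T q = p := by
  induction T using Finset.induction_on generalizing p with
  | empty =>
    refine ⟨p, ?_⟩
    have : blockHom R lam ∅ = AlgHom.id R _ := by
      ext1 x
      exact blockHom_X_of_notMem (by simp)
    rw [this]
    rfl
  | insert i T hi ih =>
    obtain ⟨q, rfl⟩ := ih fun σ hσ h ↦ hp σ hσ fun x hx ↦ h x fun h' ↦ hx (by simp [h'])
    obtain ⟨r, rfl⟩ := exists_blockHom_singleton_eq i (p := q) fun σ hσ h ↦ by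
      apply blockHom_injective T
      rw [blockHom_rename_of_preserves T hσ fun x hx ↦ h x fun h' ↦ hi (h' ▸ hx)]
      exact hp σ hσ fun x hx ↦ h x fun h' ↦ hx (by simp [h'])
    exact ⟨r, blockHom_insert hi r⟩

variable [Fintype ι]

lemma rename_blockHom_univ {σ : Equiv.Perm (Σ i, Fin (lam i))} (hσ : ∀ x, (σ x).1 = x.1)
    (p : MvPolynomial (Σ i, Fin (lam i)) R) :
    rename σ (blockHom R lam Finset.univ p) = blockHom R lam Finset.univ p := by
  rw [← AlgHom.comp_apply]
  congr 1
  ext1 x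
  rw [AlgHom.comp_apply, blockHom_X_of_mem (Finset.mem_univ _), rename_blockEsymm hσ]

lemma blockHom_coeff_prod {d : ℕ} (hd : d ≤ ∑ i, lam i) :
    blockHom R lam Finset.univ ((∏ i : ι,
      ((∑ j : Fin (lam i), Polynomial.C (X (⟨i, j⟩ : Σ i, Fin (lam i))) *
          Polynomial.X ^ (j : ℕ)) + Polynomial.X ^ (lam i))).coeff d) =
      esymm (Σ i, Fin (lam i)) R (∑ i, lam i - d) := by
  have hcard : Fintype.card (Σ i, Fin (lam i)) = ∑ i, lam i := by simp
  have hmap : blockHom R lam Finset.univ ((∏ i : ι,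
      ((∑ j : Fin (lam i), Polynomial.C (X (⟨i, j⟩ : Σ i, Fin (lam i))) *
          Polynomial.X ^ (j : ℕ)) + Polynomial.X ^ (lam i))).coeff d) =
      ((∏ i : ι, ((∑ j : Fin (lam i), Polynomial.C (X (⟨i, j⟩ : Σ i, Fin (lam i))) *
          Polynomial.X ^ (j : ℕ)) + Polynomial.X ^ (lam i))).map
            (blockHom R lam Finset.univ).toRingHom).coeff d := by
    rw [Polynomial.coeff_map]; rfl
  rw [hmap, Polynomial.map_prod]
  simp only [Polynomial.map_add, Polynomial.map_sum, Polynomial.map_X, Polynomial.map_C,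
    Polynomial.map_mul, Polynomial.map_pow, AlgHom.toRingHom_eq_coe, RingHom.coe_coe,
    blockHom_X_of_mem (Finset.mem_univ _), sum_blockEsymm_eq_prod]
  rw [← Fintype.prod_sigma' fun i j ↦ Polynomial.X + Polynomial.C (X (⟨i, j⟩ : Σ i, Fin (lam i)))]
  rw [MvPolynomial.prod_X_add_C_coeff R _ d (by rwa [hcard]), hcard]

end Blocks

section Averaging

variable {k : Type*} [Field k] {τ : Type*}

/-- The sum of the images of a polynomial under a finite set of permutations of the variables. -/
noncomputable def permSum (G : Finset (Equiv.Perm τ)) : MvPolynomial τ k →ₗ[k] MvPolynomial τ k :=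
  ∑ g ∈ G, (rename g).toLinearMap

lemma permSum_apply (G : Finset (Equiv.Perm τ)) (p : MvPolynomial τ k) :
    permSum G p = ∑ g ∈ G, rename g p := by
  simp [permSum]

lemma permSum_mul_of_invariant {G : Finset (Equiv.Perm τ)} {q : MvPolynomial τ k}
    (hq : ∀ g ∈ G, rename g q = q) (p : MvPolynomial τ k) :
    permSum G (p * q) = permSum G p * q := by
  rw [permSum_apply, permSum_apply, Finset.sum_mul]
  exact Finset.sum_congr rfl fun g hg ↦ by rw [map_mul, hq g hg]

lemma rename_permSum {G : Finset (Equiv.Perm τ)} {σ : Equiv.Perm τ}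
    (hσ : ∀ g, σ * g ∈ G ↔ g ∈ G) (p : MvPolynomial τ k) :
    rename σ (permSum G p) = permSum G p := by
  rw [permSum_apply, map_sum]
  refine Finset.sum_equiv (Equiv.mulLeft σ) (fun g ↦ (hσ g).symm) fun g _ ↦ ?_
  rw [rename_rename]
  rfl

lemma permSum_of_invariant {G : Finset (Equiv.Perm τ)} {q : MvPolynomial τ k}
    (hq : ∀ g ∈ G, rename g q = q) : permSum G q = (G.card : k) • q := by
  rw [permSum_apply, Finset.sum_congr rfl hq, Finset.sum_const, Nat.cast_smul_eq_nsmul]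

end Averaging

lemma constantCoeff_esymm_of_pos (σ R : Type*) [CommRing R] [Fintype σ] {d : ℕ} (hd : 0 < d) :
    constantCoeff (esymm σ R d) = 0 := by
  rw [esymm, map_sum]
  refine Finset.sum_eq_zero fun t ht ↦ ?_
  obtain ⟨x, hx⟩ : t.Nonempty :=
    Finset.card_pos.1 (by rwa [(Finset.mem_powersetCard.1 ht).2])
  rw [map_prod]
  exact Finset.prod_eq_zero hx (by simp)

/-- A symmetric polynomial without constant term is the image under `φ` of an element of `I`, as
soon as every elementary symmetric polynomial of positive degree is. -/
lemma IsSymmetric.exists_mem_ideal {σ τ R : Type*} [CommRing R] [Fintype σ]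
    (φ : MvPolynomial τ R →ₐ[R] MvPolynomial σ R) (I : Ideal (MvPolynomial τ R))
    (hφ : ∀ d, 0 < d → d ≤ Fintype.card σ → ∃ c ∈ I, φ c = esymm σ R d)
    {q : MvPolynomial σ R} (hq : q.IsSymmetric) (h0 : constantCoeff q = 0) :
    ∃ c ∈ I, φ c = q := by
  choose c hcI hc using fun j : Fin (Fintype.card σ) ↦ hφ (j + 1) (by omega) (by omega)
  obtain ⟨r, hr⟩ := esymmAlgHom_surjective R (σ := σ) le_rfl ⟨q, hq⟩
  have hr' : aeval (fun i : Fin (Fintype.card σ) ↦ esymm σ R (i + 1)) r = q := by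
    rw [← esymmAlgHom_apply, hr]
  have hr0 : constantCoeff r = 0 := by
    rw [← h0, ← hr', ← RingHom.coe_coe (aeval _), ← RingHom.comp_apply]
    congr 1
    ext i
    · simp
    · simp [constantCoeff_esymm_of_pos]
  refine ⟨aeval c r, ?_, ?_⟩
  · rw [← Ideal.Quotient.eq_zero_iff_mem, ← Ideal.Quotient.mkₐ_eq_mk R, ← AlgHom.comp_apply]
    have : (Ideal.Quotient.mkₐ R I).comp (aeval c) = aeval (0 : Fin (Fintype.card σ) → _) := by
      ext1 j
      simpa using Ideal.Quotient.eq_zero_iff_mem.2 (hcI j)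
    rw [this, aeval_zero, hr0, map_zero]
  · rw [← AlgHom.comp_apply, ← hr']
    congr 1
    ext1 j
    simp [hc]

end MvPolynomial

/-- The variables `z_1,…,z_ℓ` are indexed by `Σ i : Fin n, Fin (λ i)`
(so `ℓ = λ_1 + ⋯ + λ_n`).  `A_λ(k)` is the `k`-subalgebra of `k[z]/I_S` consisting of
the images of all λ-symmetric polynomials.  `C_λ(k)` is the quotient of the polynomial
ring `k[y_{i,j} : 1 ≤ i ≤ n, 0 ≤ j ≤ λ_i - 1]` (whose variables are indexed by the same
sigma type) by the ideal generated by the coefficients of `t^0,…,t^{ℓ-1}` in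
`∏_{i=1}^n (y_{i,0} + y_{i,1} t + ⋯ + y_{i,λ_i-1} t^{λ_i-1} + t^{λ_i})`.
Then `A_λ(k)` and `C_λ(k)` are isomorphic as `k`-algebras. -/
theorem lamSym_subalgebra_iso_C
    (k : Type*) [Field k] [CharZero k] {n : ℕ} (lam : Fin n → ℕ)
    (IS : Ideal (MvPolynomial (Σ i : Fin n, Fin (lam i)) k))
    (hIS : IS = Ideal.span {q | q.IsSymmetric ∧ constantCoeff q = 0})
    (S : Subalgebra k (MvPolynomial (Σ i : Fin n, Fin (lam i)) k))
    (hS : S.carrier = {p | ∀ σ : Equiv.Perm (Σ i : Fin n, Fin (lam i)),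
      (∀ x, (σ x).1 = x.1) → rename σ p = p})
    (A : Subalgebra k (MvPolynomial (Σ i : Fin n, Fin (lam i)) k ⧸ IS))
    (hA : A = S.map (Ideal.Quotient.mkₐ k IS))
    (P : Polynomial (MvPolynomial (Σ i : Fin n, Fin (lam i)) k))
    (hP : P = ∏ i : Fin n,
      ((∑ j : Fin (lam i), Polynomial.C (X (⟨i, j⟩ : Σ i : Fin n, Fin (lam i))) *
          Polynomial.X ^ (j : ℕ)) + Polynomial.X ^ (lam i)))
    (IC : Ideal (MvPolynomial (Σ i : Fin n, Fin (lam i)) k))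
    (hIC : IC = Ideal.span {q | ∃ d < ∑ i, lam i, q = P.coeff d}) :
    Nonempty (A ≃ₐ[k] (MvPolynomial (Σ i : Fin n, Fin (lam i)) k ⧸ IC)) := by
  classical
  set ρ : MvPolynomial (Σ i : Fin n, Fin (lam i)) k →ₐ[k] MvPolynomial _ k :=
    blockHom k lam Finset.univ with hρ
  have hSmem : ∀ p, p ∈ S ↔ ∀ σ : Equiv.Perm (Σ i : Fin n, Fin (lam i)),
      (∀ x, (σ x).1 = x.1) → rename σ p = p := fun p ↦ by
    rw [← Subalgebra.mem_carrier, hS]; rfl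
  have hrange : ∀ p, p ∈ S ↔ ∃ q, ρ q = p := fun p ↦ by
    rw [hSmem]
    refine ⟨fun h ↦ exists_blockHom_eq Finset.univ fun σ hσ _ ↦ h σ hσ, ?_⟩
    rintro ⟨q, rfl⟩ σ hσ
    exact rename_blockHom_univ hσ q
  have hinj : Function.Injective ρ := blockHom_injective _
  have hcoeff : ∀ d ≤ ∑ i, lam i, ρ (P.coeff d) = esymm _ k (∑ i, lam i - d) := fun d hd ↦ by
    rw [hP]; exact blockHom_coeff_prod hd
  have hIC_le : ∀ c ∈ IC, ρ c ∈ IS := by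
    suffices IC ≤ IS.comap ρ from this
    rw [hIC, Ideal.span_le]
    rintro _ ⟨d, hd, rfl⟩
    rw [SetLike.mem_coe, Ideal.mem_comap, hcoeff d hd.le, hIS]
    exact Ideal.subset_span ⟨esymm_isSymmetric _ _ _, constantCoeff_esymm_of_pos _ _ (by omega)⟩
  have hsymm : ∀ q : MvPolynomial (Σ i : Fin n, Fin (lam i)) k, q.IsSymmetric →
      constantCoeff q = 0 → ∃ c ∈ IC, ρ c = q := fun q hq h0 ↦ by
    refine hq.exists_mem_ideal ρ IC (fun d hd hd' ↦ ?_) h0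
    have hd'' : d ≤ ∑ i, lam i := by simpa using hd'
    refine ⟨P.coeff (∑ i, lam i - d), ?_, ?_⟩
    · rw [hIC]
      exact Ideal.subset_span ⟨_, by omega, rfl⟩
    · rw [hcoeff _ (Nat.sub_le _ _), Nat.sub_sub_self hd'']
  let G : Finset (Equiv.Perm (Σ i : Fin n, Fin (lam i))) := {σ | ∀ x, (σ x).1 = x.1}
  have hG : ∀ σ, σ ∈ G ↔ ∀ x, (σ x).1 = x.1 := fun σ ↦ by simp [G]
  have hGS : ∀ p, permSum G p ∈ S := fun p ↦ (hSmem _).2 fun σ hσ ↦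
    rename_permSum (fun g ↦ by simp only [hG, Equiv.Perm.mul_apply, hσ]) p
  have havg : ∀ p ∈ IS, ∀ a, ∃ c ∈ IC, ρ c = permSum G (a * p) := by
    intro p hp
    rw [hIS] at hp
    induction hp using Submodule.span_induction with
    | mem q hq =>
      intro a
      obtain ⟨c, hc, rfl⟩ := hsymm q hq.1 hq.2
      obtain ⟨b, hb⟩ := (hrange _).1 (hGS a)
      refine ⟨b * c, IC.mul_mem_left _ hc, ?_⟩
      rw [permSum_mul_of_invariant fun g _ ↦ hq.1 g, map_mul, hb]
    | zero => exact fun a ↦ ⟨0, IC.zero_mem, by simp⟩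
    | add p q _ _ hp hq =>
      intro a
      obtain ⟨c, hc, hc'⟩ := hp a
      obtain ⟨d, hd, hd'⟩ := hq a
      exact ⟨c + d, IC.add_mem hc hd, by rw [map_add, hc', hd', mul_add, map_add]⟩
    | smul b p _ hp =>
      intro a
      obtain ⟨c, hc, hc'⟩ := hp (a * b)
      exact ⟨c, hc, by rw [hc', smul_eq_mul, mul_assoc]⟩
  have hle_IC : ∀ c, ρ c ∈ IS → c ∈ IC := fun c hc ↦ by
    obtain ⟨d, hd, hd'⟩ := havg _ hc 1
    have hGc : (G.card : k) ≠ 0 :=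
      Nat.cast_ne_zero.2 (Finset.card_ne_zero_of_mem ((hG 1).2 fun _ ↦ rfl))
    rw [one_mul, permSum_of_invariant fun g hg ↦ rename_blockHom_univ ((hG g).1 hg) c,
      ← map_smul] at hd'
    have hdc : d = (G.card : k) • c := hinj hd'
    have : c = C (G.card : k)⁻¹ * d := by
      rw [← smul_eq_C_mul, hdc, inv_smul_smul₀ hGc]
    rw [this]
    exact IC.mul_mem_left _ hd
  subst hA
  have hmem : ∀ p, Ideal.Quotient.mkₐ k IS (ρ p) ∈ S.map (Ideal.Quotient.mkₐ k IS) := fun p ↦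
    ⟨ρ p, (hrange _).2 ⟨p, rfl⟩, rfl⟩
  let ψ : MvPolynomial (Σ i : Fin n, Fin (lam i)) k →ₐ[k] S.map (Ideal.Quotient.mkₐ k IS) :=
    ((Ideal.Quotient.mkₐ k IS).comp ρ).codRestrict _ hmem
  have hψ : Function.Surjective ψ := by
    rintro ⟨_, p, hp, rfl⟩
    obtain ⟨q, rfl⟩ := (hrange p).1 hp
    exact ⟨q, rfl⟩
  have hker : RingHom.ker ψ = IC := by
    ext c
    rw [RingHom.mem_ker, ← Subtype.coe_inj]
    change Ideal.Quotient.mk IS (ρ c) = 0 ↔ _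
    rw [Ideal.Quotient.eq_zero_iff_mem]
    exact ⟨hle_IC c, hIC_le c⟩
  exact ⟨((Ideal.quotientEquivAlgOfEq k hker.symm).trans
    (Ideal.quotientKerAlgEquivOfSurjective hψ)).symm⟩
end

section
/- Let n, m be positive integers and λ = (λ_1,…,λ_n) ∈ ℤ_{≥0}^n with λ_1+⋯+λ_n = m+1. Then the localization (R_m/J_m(x_1⋯x_n))_{𝔭_λ} of R_m/J_m(x_1⋯x_n) at the prime ideal 𝔭_λ is isomorphic as a ring to A_λ(K_λ). -/
open MvPolynomial

set_option synthInstance.maxHeartbeats 1000000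
set_option maxHeartbeats 1000000

theorem Polynomial.isCoprime_of_coeff_isNilpotent {Q : Type*} [CommRing Q]
    {u g : Polynomial Q} (hu : IsUnit (u.coeff 0)) (hg : g.Monic)
    (hgn : ∀ j < g.natDegree, IsNilpotent (g.coeff j)) : IsCoprime g u := by
  have h1 : IsCoprime (Polynomial.X : Polynomial Q) u := by
    obtain ⟨c, hc⟩ := hu.exists_left_inv
    refine ⟨-(Polynomial.C c * u.divX), Polynomial.C c, ?_⟩
    conv_lhs => enter [2, 2]; rw [← Polynomial.divX_mul_X_add u]
    linear_combination congrArg Polynomial.C hc + Polynomial.C_mul (R := Q) (a := c) (b := u.coeff 0)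
      * (-1) + (Polynomial.C_1 (R := Q))
  obtain ⟨a, b, hab⟩ := h1.pow_left (m := g.natDegree)
  have hn : IsNilpotent (g - Polynomial.X ^ g.natDegree) := by
    rw [Polynomial.isNilpotent_iff]
    intro j
    rw [Polynomial.coeff_sub, Polynomial.coeff_X_pow]
    rcases lt_trichotomy j g.natDegree with h | h | h
    · simpa [h.ne] using hgn j h
    · simp [h, hg.coeff_natDegree]
    · simp [h.ne', Polynomial.coeff_eq_zero_of_natDegree_lt h]
  have hun : IsUnit (1 + a * (g - Polynomial.X ^ g.natDegree)) :=
    ((Commute.all _ _).isNilpotent_mul_left hn).isUnit_one_add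
  obtain ⟨c, hc⟩ := hun.exists_left_inv
  exact ⟨c * a, c * b, by linear_combination hc + c * hab⟩

theorem Polynomial.factorization_unique_of_coeff_isNilpotent {Q : Type*} [CommRing Q]
    {u u' g g' : Polynomial Q} (hu : IsUnit (u.coeff 0)) (hg : g.Monic) (hg' : g'.Monic)
    (hd : g.natDegree = g'.natDegree)
    (hgn : ∀ j < g'.natDegree, IsNilpotent (g'.coeff j)) (h : u * g = u' * g') :
    u = u' ∧ g = g' := by
  nontriviality Q
  have hcop := Polynomial.isCoprime_of_coeff_isNilpotent hu hg' hgn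
  have hdvd : g' ∣ g - g' := by
    refine hcop.dvd_of_dvd_mul_left ⟨u' - u, ?_⟩
    linear_combination h
  have hgg : g = g' := by
    by_contra hne
    have hdeg : g.degree = g'.degree := by
      rw [Polynomial.degree_eq_natDegree hg.ne_zero, Polynomial.degree_eq_natDegree hg'.ne_zero, hd]
    refine hg'.not_dvd_of_degree_lt (sub_ne_zero.mpr hne) ?_ hdvd
    rw [← hdeg]
    exact Polynomial.degree_sub_lt_left hdeg hg.ne_zero (by rw [hg.leadingCoeff, hg'.leadingCoeff])
  subst hgg
  exact ⟨hg.isRegular.right h, rfl⟩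

theorem IsAdicComplete.of_isNilpotent {B : Type*} [CommRing B] {I : Ideal B} (hI : IsNilpotent I) :
    IsAdicComplete I B := by
  obtain ⟨N, hN⟩ := hI
  have hz : I ^ N • (⊤ : Submodule B B) = ⊥ := by
    rw [hN]; simp
  refine { haus' := fun x hx ↦ ?_, prec' := fun f hf ↦ ⟨f N, fun n ↦ ?_⟩ }
  · have := hx N
    rwa [hz, SModEq.bot] at this
  · rcases le_total n N with h | h
    · exact hf h
    · have := hf h
      rw [hz, SModEq.bot] at this
      rw [this]

theorem Polynomial.exists_factorization_of_isNilpotent_maximalIdeal {B : Type*} [CommRing B]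
    [IsLocalRing B] (hB : IsNilpotent (IsLocalRing.maximalIdeal B)) (f : Polynomial B) (l : ℕ)
    (hf : ∀ j < l, f.coeff j ∈ IsLocalRing.maximalIdeal B) (hl : IsUnit (f.coeff l)) :
    ∃ u g : Polynomial B, f = u * g ∧ g.Monic ∧ g.natDegree = l ∧ IsUnit (u.coeff 0) ∧
      ∀ j < l, g.coeff j ∈ IsLocalRing.maximalIdeal B := by
  have := IsAdicComplete.of_isNilpotent hB
  have hord : ((f : PowerSeries B).map (IsLocalRing.residue B)).order = l := by
    rw [PowerSeries.order_eq_nat]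
    constructor
    · simpa using hl
    · intro i hi
      simpa using hf i hi
  have hne : (f : PowerSeries B).map (IsLocalRing.residue B) ≠ 0 := by
    intro h
    rw [h] at hord
    simp at hord
  obtain ⟨g, h, H⟩ := PowerSeries.exists_isWeierstrassFactorization hne
  have hgm := H.isDistinguishedAt.monic
  have hgd : g.natDegree = l := by
    rw [H.natDegree_eq_toNat_order_map, hord]; rfl
  have hfg : f = g * (f /ₘ g) + f %ₘ g := by rw [add_comm, Polynomial.modByMonic_add_div]
  have hordg : ((g : PowerSeries B).map (Ideal.Quotient.mk (IsLocalRing.maximalIdeal B))).order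
      = l := by
    rw [PowerSeries.order_eq_nat]
    constructor
    · rw [PowerSeries.coeff_map, Polynomial.coeff_coe, ← hgd, hgm.coeff_natDegree, map_one]
      exact one_ne_zero
    · intro i hi
      rw [PowerSeries.coeff_map, Polynomial.coeff_coe, Ideal.Quotient.eq_zero_iff_mem]
      exact H.isDistinguishedAt.mem (hgd ▸ hi)
  have h1 : (g : PowerSeries B) * (h - ((f /ₘ g : Polynomial B) : PowerSeries B)) =
      ((f %ₘ g : Polynomial B) : PowerSeries B) := by
    rw [mul_sub, ← H.eq_mul]
    conv_lhs => enter [1]; rw [hfg]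
    simp
  obtain ⟨hh, hr⟩ := H.isDistinguishedAt.isWeierstrassDivisorAt'.eq_zero_of_mul_eq (by
    rw [hordg, ENat.toNat_natCast, ← hgd, ← Polynomial.degree_eq_natDegree hgm.ne_zero]
    exact Polynomial.degree_modByMonic_lt _ hgm) h1
  refine ⟨f /ₘ g, g, ?_, hgm, hgd, ?_, ?_⟩
  · rw [hr, add_zero] at hfg
    rw [mul_comm]; exact hfg
  · have hu := H.isUnit
    rw [sub_eq_zero.mp hh] at hu
    simpa using hu.map (PowerSeries.constantCoeff (R := B))
  · intro j hj
    exact H.isDistinguishedAt.mem (hgd ▸ hj)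

theorem AdjoinRoot.of_injective_of_monic {B : Type*} [CommRing B] {g : Polynomial B}
    (hg : g.Monic) (hd : 0 < g.natDegree) : Function.Injective (AdjoinRoot.of g) := by
  nontriviality B
  rw [injective_iff_map_eq_zero]
  intro a ha
  by_contra hne
  rw [← AdjoinRoot.mk_C, AdjoinRoot.mk_eq_zero] at ha
  refine hg.not_dvd_of_natDegree_lt (Polynomial.C_ne_zero.mpr hne) ?_ ha
  simpa using hd

theorem Polynomial.Monic.exists_injective_map_eq_prod.{u} (n : ℕ) : ∀ {B : Type u} [CommRing B]
    {g : Polynomial B} (_ : g.Monic) (_ : g.natDegree = n),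
    ∃ (B' : Type u) (_ : CommRing B') (ι : B →+* B'), Function.Injective ι ∧
      ∃ z : Fin n → B', g.map ι = ∏ j, (Polynomial.X - Polynomial.C (z j)) := by
  induction n with
  | zero =>
    intro B _ g hg hn
    refine ⟨B, inferInstance, RingHom.id B, Function.injective_id, Fin.elim0, ?_⟩
    rw [hg.natDegree_eq_zero.mp hn]
    simp
  | succ n ih =>
    intro B _ g hg hn
    rcases subsingleton_or_nontrivial B with hB | hB
    · simp [Subsingleton.elim g 0] at hn
    have hinj := AdjoinRoot.of_injective_of_monic hg (by omega)
    have : Nontrivial (AdjoinRoot g) := hinj.nontrivial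
    have hroot : (g.map (AdjoinRoot.of g)).IsRoot (AdjoinRoot.root g) := AdjoinRoot.isRoot_root g
    obtain ⟨q, hq⟩ := Polynomial.dvd_iff_isRoot.mpr hroot
    have hqm : q.Monic := (Polynomial.monic_X_sub_C _).of_mul_monic_left (hq ▸ hg.map _)
    have hqd : q.natDegree = n := by
      have := congrArg Polynomial.natDegree hq
      rw [hg.natDegree_map, (Polynomial.monic_X_sub_C _).natDegree_mul hqm,
        Polynomial.natDegree_X_sub_C] at this
      omega
    obtain ⟨B', _, ι, hι, z, hz⟩ := ih hqm hqd
    refine ⟨B', inferInstance, ι.comp (AdjoinRoot.of g), hι.comp hinj,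
      Fin.cons (ι (AdjoinRoot.root g)) z, ?_⟩
    rw [← Polynomial.map_map, hq, Polynomial.map_mul, hz, Fin.prod_univ_succ]
    simp

theorem Polynomial.exists_injective_forall_map_eq_prod.{u} {ι : Type*} [Fintype ι] {B : Type u}
    [CommRing B] (g : ι → Polynomial B) (hg : ∀ i, (g i).Monic) (l : ι → ℕ)
    (hl : ∀ i, (g i).natDegree = l i) :
    ∃ (B' : Type u) (_ : CommRing B') (φ : B →+* B'), Function.Injective φ ∧
      ∃ z : (Σ i, Fin (l i)) → B',
        ∀ i, (g i).map φ = ∏ j, (Polynomial.X - Polynomial.C (z ⟨i, j⟩)) := by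
  classical
  suffices ∀ s : Finset ι, ∃ (B' : Type u) (_ : CommRing B') (φ : B →+* B'),
      Function.Injective φ ∧ ∀ i ∈ s, ∃ z : Fin (l i) → B',
        (g i).map φ = ∏ j, (Polynomial.X - Polynomial.C (z j)) by
    obtain ⟨B', _, φ, hφ, h⟩ := this Finset.univ
    choose z hz using fun i ↦ h i (Finset.mem_univ i)
    exact ⟨B', inferInstance, φ, hφ, fun x ↦ z x.1 x.2, hz⟩
  intro s
  rcases subsingleton_or_nontrivial B with hB | hB
  · exact ⟨B, inferInstance, RingHom.id B, Function.injective_id,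
      fun i _ ↦ ⟨0, Subsingleton.elim _ _⟩⟩
  induction s using Finset.induction_on with
  | empty => exact ⟨B, inferInstance, RingHom.id B, Function.injective_id, by simp⟩
  | insert a s ha ih =>
    obtain ⟨B', _, φ, hφ, h⟩ := ih
    have : Nontrivial B' := hφ.nontrivial
    obtain ⟨B'', _, φ', hφ', z, hz⟩ := Polynomial.Monic.exists_injective_map_eq_prod (l a)
      ((hg a).map φ) (by rw [(hg a).natDegree_map, hl])
    refine ⟨B'', inferInstance, φ'.comp φ, hφ'.comp hφ, fun i hi ↦ ?_⟩
    rcases Finset.mem_insert.mp hi with rfl | hi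
    · exact ⟨z, by rw [← Polynomial.map_map, hz]⟩
    · obtain ⟨w, hw⟩ := h i hi
      refine ⟨fun j ↦ φ' (w j), ?_⟩
      rw [← Polynomial.map_map, hw, Polynomial.map_prod]
      simp

theorem Polynomial.coeff_eq_zero_of_X_pow_dvd_prod {ι D : Type*} [Fintype ι] [CommRing D] [IsDomain D]
    (f : ι → Polynomial D) (l : ι → ℕ) (hdvd : Polynomial.X ^ (∑ i, l i) ∣ ∏ i, f i)
    (hl : ∀ i, (f i).coeff (l i) ≠ 0) (i : ι) (j : ℕ) (hj : j < l i) : (f i).coeff j = 0 := by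
  classical
  have hne : ∀ i, f i ≠ 0 := fun i h ↦ hl i (by simp [h])
  have hle : ∀ i, (f i).natTrailingDegree ≤ l i := fun i ↦
    Polynomial.natTrailingDegree_le_of_ne_zero (hl i)
  have hprod : ∀ s : Finset ι, (∏ i ∈ s, f i).natTrailingDegree = 
      ∑ i ∈ s, (f i).natTrailingDegree := by
    intro s
    induction s using Finset.induction_on with
    | empty => simp
    | insert a s ha ih =>
      rw [Finset.prod_insert ha, Finset.sum_insert ha, Polynomial.natTrailingDegree_mul (hne a)
        (Finset.prod_ne_zero_iff.mpr fun i _ ↦ hne i), ih]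
  have hge : ∑ i, l i ≤ ∑ i, (f i).natTrailingDegree := by
    rw [← hprod]
    refine Polynomial.le_natTrailingDegree (Finset.prod_ne_zero_iff.mpr fun i _ ↦ hne i) ?_
    intro d hd
    exact Polynomial.X_pow_dvd_iff.mp hdvd d hd
  have heq := (Finset.sum_eq_sum_iff_of_le fun i _ ↦ hle i).mp
    (le_antisymm (Finset.sum_le_sum fun i _ ↦ hle i) hge) i (Finset.mem_univ _)
  exact Polynomial.coeff_eq_zero_of_lt_natTrailingDegree (heq ▸ hj)


theorem MvPolynomial.mem_adjoin_rename_esymm {K ι : Type*} [Field K] [CharZero K] [Fintype ι]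
    (l : ι → ℕ) (p : MvPolynomial (Σ i, Fin (l i)) K)
    (hp : ∀ σ : Equiv.Perm (Σ i, Fin (l i)), (∀ x, (σ x).1 = x.1) → rename σ p = p) :
    p ∈ Algebra.adjoin K {q : MvPolynomial (Σ i, Fin (l i)) K |
      ∃ (i : ι) (r : ℕ), r ≤ l i ∧ q = rename (Sigma.mk i) (esymm (Fin (l i)) K r)} := by
  classical
  set D := Algebra.adjoin K {q : MvPolynomial (Σ i, Fin (l i)) K |
      ∃ (i : ι) (r : ℕ), r ≤ l i ∧ q = rename (Sigma.mk i) (esymm (Fin (l i)) K r)} with hD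
  have hblock : ∀ (i : ι) (q : MvPolynomial (Fin (l i)) K), q.IsSymmetric →
      rename (Sigma.mk i) q ∈ D := by
    intro i q hq
    obtain ⟨a, ha⟩ := esymmAlgHom_surjective (R := K) (σ := Fin (l i)) (n := l i) (by simp) ⟨q, hq⟩
    have ha' : q = aeval (fun j : Fin (l i) ↦ esymm (Fin (l i)) K (j + 1)) a := by
      rw [← esymmAlgHom_apply, ha]
    have h := (aeval (fun j : Fin (l i) ↦ (⟨rename (Sigma.mk i) (esymm (Fin (l i)) K (j + 1)),
      Algebra.subset_adjoin ⟨i, j + 1, j.2, rfl⟩⟩ : D)) a).2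
    rw [← Subalgebra.mvPolynomial_aeval_coe] at h
    rwa [ha', ← AlgHom.comp_apply, comp_aeval]
  have hsum : ∀ q : MvPolynomial (Σ i, Fin (l i)) K,
      ∑ τ : ∀ i, Equiv.Perm (Fin (l i)), rename (Equiv.sigmaCongrRight τ) q ∈ D := by
    intro q
    induction q using MvPolynomial.induction_on' with
    | add q₁ q₂ h₁ h₂ =>
      simp only [map_add, Finset.sum_add_distrib]
      exact D.add_mem h₁ h₂
    | monomial u a =>
      have hterm : ∀ τ : ∀ i, Equiv.Perm (Fin (l i)),
          rename (Equiv.sigmaCongrRight τ) (monomial u a) = C a *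
            ∏ i, rename (Sigma.mk i) (rename (τ i) (∏ j, (X j : MvPolynomial (Fin (l i)) K)
              ^ u ⟨i, j⟩)) := by
        intro τ
        rw [monomial_eq, Finsupp.prod_fintype _ _ (by simp), map_mul, rename_C,
          Fintype.prod_sigma, map_prod]
        simp [map_prod, map_pow, rename_X]
      rw [Finset.sum_congr rfl fun τ _ ↦ hterm τ, ← Finset.mul_sum]
      refine D.mul_mem (D.algebraMap_mem a) ?_
      have := Finset.prod_univ_sum (fun i ↦ (Finset.univ : Finset (Equiv.Perm (Fin (l i)))))
        (fun i τ ↦ rename (Sigma.mk i) (rename τ (∏ j, (X j : MvPolynomial (Fin (l i)) K)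
              ^ u ⟨i, j⟩)))
      rw [Fintype.piFinset_univ] at this
      rw [← this]
      refine D.prod_mem fun i _ ↦ ?_
      rw [← map_sum]
      refine hblock i _ fun e ↦ ?_
      rw [map_sum]
      refine Fintype.sum_equiv (Equiv.mulLeft e) _ _ fun τ ↦ ?_
      rw [rename_rename]
      rfl
  have hcard : (Fintype.card (∀ i, Equiv.Perm (Fin (l i))) : K) ≠ 0 :=
    Nat.cast_ne_zero.mpr Fintype.card_ne_zero
  have := hsum p
  rw [Finset.sum_congr rfl fun τ _ ↦ hp (Equiv.sigmaCongrRight τ) (fun x ↦ rfl)] at this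
  rw [Finset.sum_const, Finset.card_univ, ← Nat.cast_smul_eq_nsmul K] at this
  have h2 := D.smul_mem this (Fintype.card (∀ i, Equiv.Perm (Fin (l i))) : K)⁻¹
  rwa [smul_smul, inv_mul_cancel₀ hcard, one_smul] at h2


theorem MvPolynomial.map_prod_X_sub_C_rename {K σ : Type*} [CommRing K] [Fintype σ]
    (e : Equiv.Perm σ) :
    (∏ x : σ, (Polynomial.X - Polynomial.C (X x : MvPolynomial σ K))).map
      (rename e : MvPolynomial σ K →ₐ[K] MvPolynomial σ K).toRingHom =
      ∏ x : σ, (Polynomial.X - Polynomial.C (X x : MvPolynomial σ K)) := by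
  rw [Polynomial.map_prod]
  refine Fintype.prod_equiv e _ _ fun x ↦ ?_
  simp

theorem MvPolynomial.prod_X_sub_C_quotient_eq {K σ : Type*} [CommRing K] [Nontrivial K] [Fintype σ]
    {I : Ideal (MvPolynomial σ K)} (hI : I = Ideal.span {q | q.IsSymmetric ∧ constantCoeff q = 0}) :
    ∏ x : σ, (Polynomial.X - Polynomial.C (Ideal.Quotient.mk I (X x))) =
      Polynomial.X ^ Fintype.card σ := by
  set p := ∏ x : σ, (Polynomial.X - Polynomial.C (X x : MvPolynomial σ K)) with hp
  have hpm : p.Monic := Polynomial.monic_prod_of_monic _ _ fun x _ ↦ Polynomial.monic_X_sub_C _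
  have hpd : p.natDegree = Fintype.card σ := by
    rw [Polynomial.natDegree_prod_of_monic _ _ fun x _ ↦ Polynomial.monic_X_sub_C _]
    simp
  have h0 : p.map constantCoeff = Polynomial.X ^ Fintype.card σ := by
    simp [hp, Polynomial.map_prod]
  have h1 : ∏ x : σ, (Polynomial.X - Polynomial.C (Ideal.Quotient.mk I (X x))) =
      p.map (Ideal.Quotient.mk I) := by
    simp [hp, Polynomial.map_prod]
  rw [h1]
  ext d
  rw [Polynomial.coeff_map, Polynomial.coeff_X_pow]
  split_ifs with hd
  · rw [hd, ← hpd, hpm.coeff_natDegree, map_one]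
  · rw [Ideal.Quotient.eq_zero_iff_mem, hI]
    refine Ideal.subset_span ⟨fun e ↦ ?_, ?_⟩
    · have := congrArg (Polynomial.coeff · d) (map_prod_X_sub_C_rename (K := K) e)
      simpa [hp] using this
    · have := congrArg (Polynomial.coeff · d) h0
      simpa [Polynomial.coeff_X_pow, hd] using this

theorem MvPolynomial.isNilpotent_mk_of_constantCoeff_eq_zero {K σ : Type*} [CommRing K]
    [Nontrivial K] [Fintype σ] {I : Ideal (MvPolynomial σ K)}
    (hI : I = Ideal.span {q | q.IsSymmetric ∧ constantCoeff q = 0}) {p : MvPolynomial σ K}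
    (hp : constantCoeff p = 0) : IsNilpotent (Ideal.Quotient.mk I p) := by
  have hX : ∀ x : σ, IsNilpotent (Ideal.Quotient.mk I (X x)) := fun x ↦ by
    refine ⟨Fintype.card σ, ?_⟩
    have := congrArg (Polynomial.eval (Ideal.Quotient.mk I (X x))) (prod_X_sub_C_quotient_eq hI)
    rw [Polynomial.eval_prod, Finset.prod_eq_zero (Finset.mem_univ x) (by simp)] at this
    simpa using this.symm
  let N := nilradical (MvPolynomial σ K ⧸ I)
  have h : (Ideal.Quotient.mk N).comp (Ideal.Quotient.mk I) =
      ((Ideal.Quotient.mk N).comp ((Ideal.Quotient.mk I).comp C)).comp constantCoeff := by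
    ext x
    · simp
    · simpa using Ideal.Quotient.eq_zero_iff_mem.mpr (hX x)
  have h2 := congrArg (fun f ↦ f p) h
  simp only [RingHom.comp_apply, hp, map_zero] at h2
  exact Ideal.Quotient.eq_zero_iff_mem.mp h2

theorem MvPolynomial.esymm_eq_coeff_prod_X_sub_C {K σ : Type*} [CommRing K] [Fintype σ] {r : ℕ}
    (hr : r ≤ Fintype.card σ) : esymm σ K r = (-1) ^ r *
      (∏ x : σ, (Polynomial.X - Polynomial.C (X x : MvPolynomial σ K))).coeff
        (Fintype.card σ - r) := by
  have h1 := Multiset.prod_X_sub_C_coeff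
    ((Finset.univ : Finset σ).val.map (X : σ → MvPolynomial σ K)) (k := Fintype.card σ - r)
    (by simp)
  rw [← aeval_esymm_eq_multiset_esymm σ K, aeval_X_left, AlgHom.id_apply, Multiset.map_map,
    Multiset.card_map, Finset.card_val, Finset.card_univ, Nat.sub_sub_self hr] at h1
  have h2 : (∏ x : σ, (Polynomial.X - Polynomial.C (X x : MvPolynomial σ K))).coeff
      (Fintype.card σ - r) = (-1) ^ r * esymm σ K r := h1
  rw [h2, ← mul_assoc, ← mul_pow]
  simp

theorem MvPolynomial.map_esymm_eq_zero {K σ T : Type*} [CommRing K] [Fintype σ] [CommRing T]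
    (θ : MvPolynomial σ K →+* T)
    (hθ : ∏ x : σ, (Polynomial.X - Polynomial.C (θ (X x))) = Polynomial.X ^ Fintype.card σ)
    {r : ℕ} (hr : 0 < r) (hrc : r ≤ Fintype.card σ) : θ (esymm σ K r) = 0 := by
  have h2 := congrArg (Polynomial.coeff · (Fintype.card σ - r)) hθ
  have h3 : ∏ x : σ, (Polynomial.X - Polynomial.C (θ (X x))) =
      (∏ x : σ, (Polynomial.X - Polynomial.C (X x : MvPolynomial σ K))).map θ := by
    simp [Polynomial.map_prod]
  simp only [h3, Polynomial.coeff_map, Polynomial.coeff_X_pow] at h2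
  rw [if_neg (by omega)] at h2
  rw [esymm_eq_coeff_prod_X_sub_C hrc, map_mul, h2, mul_zero]

theorem MvPolynomial.IsSymmetric.map_eq_zero {K σ T : Type*} [CommRing K] [Fintype σ] [CommRing T]
    (θ : MvPolynomial σ K →+* T)
    (hθ : ∏ x : σ, (Polynomial.X - Polynomial.C (θ (X x))) = Polynomial.X ^ Fintype.card σ)
    {p : MvPolynomial σ K} (hp : p.IsSymmetric) (h0 : constantCoeff p = 0) : θ p = 0 := by
  obtain ⟨a, ha⟩ := esymmAlgHom_surjective (R := K) (σ := σ) (n := Fintype.card σ) le_rfl ⟨p, hp⟩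
  have ha' : p = aeval (fun j : Fin (Fintype.card σ) ↦ esymm σ K (j + 1)) a := by
    rw [← esymmAlgHom_apply, ha]
  have hc : θ.comp (aeval (fun j : Fin (Fintype.card σ) ↦ esymm σ K (j + 1))).toRingHom =
      (θ.comp MvPolynomial.C).comp constantCoeff := by
    ext j
    · simp
    · simpa using map_esymm_eq_zero θ hθ (Nat.succ_pos _) j.2
  have hc' : constantCoeff.comp (aeval (fun j : Fin (Fintype.card σ) ↦ esymm σ K (j + 1))).toRingHom
      = constantCoeff := by
    ext j
    · simp
    · simpa using map_esymm_eq_zero (K := K) (σ := σ) constantCoeff (by simp) (Nat.succ_pos _) j.2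
  have ha0 : constantCoeff a = 0 := by
    rw [← hc', ← h0, ha']; rfl
  have := congrArg (fun f ↦ f a) hc
  simp only [RingHom.comp_apply, ha0, map_zero] at this
  rw [ha']; exact this

/-- The polynomial `∑_{j ≤ m} x_j t^j`, completed by `t^(m+1)` when `l = m + 1`, so that its
coefficient of `t^l` is the first one expected to be invertible. -/
noncomputable def jetPoly {T : Type*} [CommRing T] (m l : ℕ) (x : Fin (m + 1) → T) :
    Polynomial T :=
  (∑ j : Fin (m + 1), Polynomial.C (x j) * Polynomial.X ^ (j : ℕ)) +
    if l = m + 1 then Polynomial.X ^ (m + 1) else 0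

theorem coeff_jetPoly {T : Type*} [CommRing T] (m l : ℕ) (x : Fin (m + 1) → T) (d : ℕ) :
    (jetPoly m l x).coeff d =
      if h : d < m + 1 then x ⟨d, h⟩ else if l = m + 1 ∧ d = m + 1 then 1 else 0 := by
  have hlast : (if l = m + 1 then (Polynomial.X : Polynomial T) ^ (m + 1) else 0).coeff d =
      if l = m + 1 ∧ d = m + 1 then 1 else 0 := by
    by_cases hl : l = m + 1 <;> simp [hl, Polynomial.coeff_X_pow]
  rw [jetPoly, Polynomial.coeff_add, Polynomial.finsetSum_coeff, hlast]
  simp only [Polynomial.coeff_C_mul, Polynomial.coeff_X_pow, mul_ite, mul_one, mul_zero]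
  by_cases h : d < m + 1
  · rw [dif_pos h, Finset.sum_eq_single ⟨d, h⟩
      (fun b _ hb ↦ if_neg fun h ↦ hb (Fin.ext h.symm)) (by simp), if_pos rfl,
      if_neg (by omega), add_zero]
  · rw [dif_neg h, Finset.sum_eq_zero fun b _ ↦ if_neg (by have := b.2; omega), zero_add]

theorem map_jetPoly {T T' : Type*} [CommRing T] [CommRing T'] (φ : T →+* T') (m l : ℕ)
    (x : Fin (m + 1) → T) : (jetPoly m l x).map φ = jetPoly m l (fun j ↦ φ (x j)) := by
  ext d
  rw [Polynomial.coeff_map, coeff_jetPoly, coeff_jetPoly]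
  split_ifs <;> simp

theorem X_pow_dvd_prod_jetPoly_iff {ι T : Type*} [Fintype ι] [CommRing T] (m : ℕ) (l : ι → ℕ)
    (x : ι → Fin (m + 1) → T) :
    Polynomial.X ^ (m + 1) ∣ ∏ i, jetPoly m (l i) (x i) ↔
      Polynomial.X ^ (m + 1) ∣
        ∏ i, ∑ j : Fin (m + 1), Polynomial.C (x i j) * Polynomial.X ^ (j : ℕ) := by
  rw [← Ideal.mem_span_singleton, ← Ideal.mem_span_singleton, ← Ideal.Quotient.eq_zero_iff_mem,
    ← Ideal.Quotient.eq_zero_iff_mem, map_prod, map_prod]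
  refine Iff.of_eq (congrArg (· = 0) (Finset.prod_congr rfl fun i _ ↦ ?_))
  rw [jetPoly, map_add, add_eq_left, Ideal.Quotient.eq_zero_iff_mem]
  split_ifs
  · exact Ideal.mem_span_singleton_self _
  · exact Ideal.zero_mem _

/-- The polynomial `∑_{l_i ≤ j ≤ m} y_{i,j} t^(j - l_i)`, replaced by `1` when `l_i = m + 1`. -/
noncomputable def unitPoly {ι T : Type*} [CommRing T] {m : ℕ} {l : ι → ℕ}
    (y : {p : ι × Fin (m + 1) // l p.1 ≤ (p.2 : ℕ)} → T) (i : ι) : Polynomial T :=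
  (∑ j ∈ Finset.range (m + 1 - l i),
    Polynomial.C (if h : l i + j < m + 1 then y ⟨(i, ⟨l i + j, h⟩), Nat.le_add_right _ _⟩ else 0) *
      Polynomial.X ^ j) + if l i = m + 1 then 1 else 0

theorem coeff_unitPoly {ι T : Type*} [CommRing T] {m : ℕ} {l : ι → ℕ}
    (y : {p : ι × Fin (m + 1) // l p.1 ≤ (p.2 : ℕ)} → T) (i : ι) (d : ℕ) :
    (unitPoly y i).coeff d =
      if h : l i + d < m + 1 then y ⟨(i, ⟨l i + d, h⟩), Nat.le_add_right _ _⟩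
      else if l i = m + 1 ∧ d = 0 then 1 else 0 := by
  rw [unitPoly, Polynomial.coeff_add, Polynomial.finsetSum_coeff]
  simp only [Polynomial.coeff_C_mul, Polynomial.coeff_X_pow, mul_ite, mul_one, mul_zero]
  rw [Finset.sum_ite_eq]
  simp only [Finset.mem_range]
  split_ifs <;> first | omega | simp_all [Polynomial.coeff_one]

theorem map_unitPoly {ι T T' : Type*} [CommRing T] [CommRing T'] (φ : T →+* T') {m : ℕ} {l : ι → ℕ}
    (y : {p : ι × Fin (m + 1) // l p.1 ≤ (p.2 : ℕ)} → T) (i : ι) :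
    (unitPoly y i).map φ = unitPoly (fun p ↦ φ (y p)) i := by
  ext d
  rw [Polynomial.coeff_map, coeff_unitPoly, coeff_unitPoly]
  split_ifs <;> simp

theorem isUnit_coeff_zero_unitPoly {ι T : Type*} [CommRing T] {m : ℕ} {l : ι → ℕ} {i : ι}
    (hl : l i ≤ m + 1) {y : {p : ι × Fin (m + 1) // l p.1 ≤ (p.2 : ℕ)} → T}
    (hy : ∀ p, IsUnit (y p)) : IsUnit ((unitPoly y i).coeff 0) := by
  rw [coeff_unitPoly]
  split_ifs with h h
  · exact hy _
  · exact isUnit_one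
  · omega

theorem X_pow_mul_unitPoly {ι T : Type*} [CommRing T] {m : ℕ} {l : ι → ℕ} {i : ι}
    (hl : l i ≤ m + 1) (y : {p : ι × Fin (m + 1) // l p.1 ≤ (p.2 : ℕ)} → T) :
    Polynomial.X ^ l i * unitPoly y i =
      jetPoly m (l i) (fun j ↦ if h : l i ≤ (j : ℕ) then y ⟨(i, j), h⟩ else 0) := by
  ext d
  rw [Polynomial.coeff_X_pow_mul', coeff_jetPoly]
  by_cases hd : l i ≤ d
  · obtain ⟨e, rfl⟩ := Nat.exists_eq_add_of_le hd
    rw [if_pos hd, coeff_unitPoly, Nat.add_sub_cancel_left]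
    split_ifs <;> first | rfl | omega
  · rw [if_neg hd, dif_pos (by omega), dif_neg hd]

theorem unitPoly_mul_eq_jetPoly {ι T : Type*} [CommRing T] {m : ℕ} {l : ι → ℕ} {i : ι}
    (hl : l i ≤ m + 1) (y : {p : ι × Fin (m + 1) // l p.1 ≤ (p.2 : ℕ)} → T) {g : Polynomial T}
    (hg : g.Monic) (hgd : g.natDegree = l i) :
    unitPoly y i * g = jetPoly m (l i) (fun j ↦ (unitPoly y i * g).coeff j) := by
  ext d
  rw [coeff_jetPoly]
  split_ifs with h1 h2
  · rfl
  · have : unitPoly y i = 1 := by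
      ext e
      rw [coeff_unitPoly, dif_neg (by omega), Polynomial.coeff_one]
      simp [h2.1]
    rw [this, one_mul, h2.2, ← h2.1, ← hgd, hg.coeff_natDegree]
  · have hu : (unitPoly y i).natDegree ≤ m - l i := by
      rw [Polynomial.natDegree_le_iff_coeff_eq_zero]
      intro e he
      rw [coeff_unitPoly, dif_neg (by omega), if_neg (by omega)]
    refine Polynomial.coeff_eq_zero_of_natDegree_lt
      (Polynomial.natDegree_mul_le.trans_lt ?_)
    rw [hgd]
    by_cases h : l i = m + 1
    · simp [h] at h2
      omega
    · omega

theorem eq_unitPoly_of_mul_eq_jetPoly {ι T : Type*} [CommRing T] {m : ℕ} {l : ι → ℕ} {i : ι}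
    (hl : l i ≤ m + 1) {x : Fin (m + 1) → T} {u g : Polynomial T}
    (hg : g.Monic) (hgd : g.natDegree = l i) (h : jetPoly m (l i) x = u * g)
    {y : {p : ι × Fin (m + 1) // l p.1 ≤ (p.2 : ℕ)} → T}
    (hy : ∀ p, p.1.1 = i → y p = u.coeff (p.1.2 - l i)) : u = unitPoly y i := by
  have hu : u.natDegree ≤ m - l i := by
    by_cases h0 : u = 0
    · simp [h0]
    have h1 := hg.natDegree_mul' h0
    rw [mul_comm, ← h, hgd] at h1
    have h2 : (jetPoly m (l i) x).natDegree ≤ max m (l i) := by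
      rw [Polynomial.natDegree_le_iff_coeff_eq_zero]
      intro e he
      rw [coeff_jetPoly, dif_neg (by omega), if_neg (by omega)]
    omega
  ext d
  rw [coeff_unitPoly]
  split_ifs with h1 h2
  · rw [hy _ rfl]
    simp
  · have h3 := congrArg (Polynomial.coeff · (m + 1)) h
    simp only [coeff_jetPoly] at h3
    rw [dif_neg (by omega), if_pos (by simp [h2.1]),
      Polynomial.eq_C_of_natDegree_le_zero (p := u) (by omega), Polynomial.coeff_C_mul, ← h2.1,
      ← hgd, hg.coeff_natDegree, mul_one] at h3
    rw [h2.2, h3]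
  · refine Polynomial.coeff_eq_zero_of_natDegree_lt ?_
    omega

theorem exists_factorization_jetPoly {B : Type*} [CommRing B] [IsLocalRing B] [IsNoetherianRing B]
    {n m : ℕ} {lam : Fin n → ℕ} (hlam : ∑ i, lam i = m + 1) {x : Fin n → Fin (m + 1) → B}
    (hJ : Polynomial.X ^ (m + 1) ∣ ∏ i, jetPoly m (lam i) (x i))
    (hu : ∀ i (j : Fin (m + 1)), lam i ≤ (j : ℕ) → IsUnit (x i j))
    (hmax : IsLocalRing.maximalIdeal B =
      Ideal.span {b | ∃ (i : Fin n) (j : Fin (m + 1)), (j : ℕ) < lam i ∧ b = x i j}) :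
    IsNilpotent (IsLocalRing.maximalIdeal B) ∧ ∃ u g : Fin n → Polynomial B,
      (∀ i, jetPoly m (lam i) (x i) = u i * g i) ∧ (∀ i, (g i).Monic) ∧
      (∀ i, (g i).natDegree = lam i) ∧ (∀ i, ∀ j < lam i, IsNilpotent ((g i).coeff j)) ∧
      ∏ i, g i = Polynomial.X ^ (m + 1) := by
  have hle : ∀ i, lam i ≤ m + 1 := fun i ↦
    hlam ▸ Finset.single_le_sum (fun _ _ ↦ Nat.zero_le _) (Finset.mem_univ i)
  have hunit : ∀ i, IsUnit ((jetPoly m (lam i) (x i)).coeff (lam i)) := by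
    intro i
    rw [coeff_jetPoly]
    have := hle i
    split_ifs with h h
    · exact hu i _ le_rfl
    · exact isUnit_one
    · omega
  have hnil : IsLocalRing.maximalIdeal B ≤ nilradical B := by
    rw [hmax, Ideal.span_le]
    rintro _ ⟨i, j, hj, rfl⟩
    rw [SetLike.mem_coe, mem_nilradical, nilpotent_iff_mem_prime]
    intro q hq
    rw [← Ideal.Quotient.eq_zero_iff_mem]
    have h := Polynomial.coeff_eq_zero_of_X_pow_dvd_prod
      (fun i ↦ (jetPoly m (lam i) (x i)).map (Ideal.Quotient.mk q)) lam (by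
        rw [hlam]
        have := Polynomial.map_dvd (Ideal.Quotient.mk q) hJ
        rwa [Polynomial.map_pow, Polynomial.map_X, Polynomial.map_prod] at this)
      (fun i ↦ by
        rw [Polynomial.coeff_map]
        exact ((hunit i).map _).ne_zero) i j hj
    rw [Polynomial.coeff_map, coeff_jetPoly, dif_pos j.2] at h
    exact h
  have hnilp : IsNilpotent (IsLocalRing.maximalIdeal B) := by
    obtain ⟨N, hN⟩ := IsNoetherianRing.isNilpotent_nilradical B
    exact ⟨N, le_bot_iff.mp ((Ideal.pow_right_mono hnil N).trans hN.le)⟩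
  refine ⟨hnilp, ?_⟩
  have hex : ∀ i, _ := fun i ↦ Polynomial.exists_factorization_of_isNilpotent_maximalIdeal hnilp
    (jetPoly m (lam i) (x i)) (lam i) (fun j hj ↦ by
      have := hle i
      rw [coeff_jetPoly, dif_pos (by omega), hmax]
      exact Ideal.subset_span ⟨i, ⟨j, by omega⟩, hj, rfl⟩) (hunit i)
  choose u g hfac hmon hdeg hu0 hgn using hex
  refine ⟨u, g, hfac, hmon, hdeg, fun i j hj ↦ hnil (hgn i j hj), ?_⟩
  have hcop : IsCoprime (Polynomial.X ^ (m + 1)) (∏ i, u i) := by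
    refine Polynomial.isCoprime_of_coeff_isNilpotent ?_ (Polynomial.monic_X_pow _) ?_
    · rw [Polynomial.coeff_zero_prod]
      exact IsUnit.prod_univ_iff.mpr hu0
    · intro j hj
      rw [Polynomial.natDegree_X_pow] at hj
      simp [Polynomial.coeff_X_pow, hj.ne]
  rw [Finset.prod_congr rfl fun i _ ↦ hfac i, Finset.prod_mul_distrib] at hJ
  have hdvd := hcop.dvd_of_dvd_mul_left hJ
  have hpm : (∏ i, g i).Monic := Polynomial.monic_prod_of_monic _ _ fun i _ ↦ hmon i
  refine (Polynomial.eq_of_monic_of_dvd_of_natDegree_le (Polynomial.monic_X_pow _) hpm hdvd ?_)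
  rw [Polynomial.natDegree_prod_of_monic _ _ fun i _ ↦ hmon i, Polynomial.natDegree_X_pow,
    Finset.sum_congr rfl fun i _ ↦ hdeg i, hlam]

section JetHom

variable {k K : Type*} [Field k] [Field K] {n m : ℕ} {lam : Fin n → ℕ}
  [Algebra (MvPolynomial {p : Fin n × Fin (m + 1) // lam p.1 ≤ (p.2 : ℕ)} k) K]

variable (k K m lam) in
/-- The generic product of a unit polynomial and of `∏_j (t - z_{i,j})`. -/
noncomputable def jetFactor (i : Fin n) : Polynomial (MvPolynomial (Σ i : Fin n, Fin (lam i)) K) :=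
  unitPoly (fun p : {p : Fin n × Fin (m + 1) // lam p.1 ≤ (p.2 : ℕ)} ↦
      (C (algebraMap (MvPolynomial {p : Fin n × Fin (m + 1) // lam p.1 ≤ (p.2 : ℕ)} k) K (X p)) :
        MvPolynomial (Σ i : Fin n, Fin (lam i)) K)) i *
    ∏ j : Fin (lam i), (Polynomial.X - Polynomial.C (X ⟨i, j⟩))

variable (k K m lam) in
/-- The ring homomorphism sending the jet variables to the coefficients of `jetFactor`. -/
noncomputable def jetHom :
    MvPolynomial (Fin n × Fin (m + 1)) k →+* MvPolynomial (Σ i : Fin n, Fin (lam i)) K :=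
  eval₂Hom ((C.comp (algebraMap (MvPolynomial {p : Fin n × Fin (m + 1) //
      lam p.1 ≤ (p.2 : ℕ)} k) K)).comp C) (fun p ↦ (jetFactor k K m lam p.1).coeff p.2)

theorem jetHom_C (a : k) : jetHom k K m lam (C a) = C (algebraMap (MvPolynomial
    {p : Fin n × Fin (m + 1) // lam p.1 ≤ (p.2 : ℕ)} k) K (C a)) := by
  simp [jetHom]

theorem jetHom_X (p : Fin n × Fin (m + 1)) :
    jetHom k K m lam (X p) = (jetFactor k K m lam p.1).coeff p.2 := by
  simp [jetHom]

theorem jetPoly_jetHom {i : Fin n} (hi : lam i ≤ m + 1) :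
    jetPoly m (lam i) (fun j ↦ jetHom k K m lam (X (i, j))) = jetFactor k K m lam i := by
  simp only [jetHom_X]
  exact (unitPoly_mul_eq_jetPoly hi _
    (Polynomial.monic_prod_of_monic _ _ fun j _ ↦ Polynomial.monic_X_sub_C _)
    (by rw [Polynomial.natDegree_prod_of_monic _ _ fun j _ ↦ Polynomial.monic_X_sub_C _]; simp)).symm

theorem map_jetFactor {T : Type*} [CommRing T]
    (θ : MvPolynomial (Σ i : Fin n, Fin (lam i)) K →+* T) (i : Fin n) :
    (jetFactor k K m lam i).map θ =
      unitPoly (fun p : {p : Fin n × Fin (m + 1) // lam p.1 ≤ (p.2 : ℕ)} ↦ θ (C (algebraMap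
        (MvPolynomial {p : Fin n × Fin (m + 1) // lam p.1 ≤ (p.2 : ℕ)} k) K (X p)))) i *
      ∏ j : Fin (lam i), (Polynomial.X - Polynomial.C (θ (X ⟨i, j⟩))) := by
  rw [jetFactor, Polynomial.map_mul, map_unitPoly, Polynomial.map_prod]
  simp

theorem constantCoeff_jetHom_X {i : Fin n} (hi : lam i ≤ m + 1) (j : Fin (m + 1)) :
    constantCoeff (jetHom k K m lam (X (i, j))) = if h : lam i ≤ (j : ℕ) then
      algebraMap (MvPolynomial {p : Fin n × Fin (m + 1) // lam p.1 ≤ (p.2 : ℕ)} k) K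
        (X ⟨(i, j), h⟩) else 0 := by
  have h1 := map_jetFactor (k := k) (m := m) (constantCoeff (R := K)
    (σ := Σ i : Fin n, Fin (lam i))) i
  simp only [constantCoeff_C, constantCoeff_X, map_zero, sub_zero, Finset.prod_const,
    Finset.card_univ, Fintype.card_fin] at h1
  rw [mul_comm, X_pow_mul_unitPoly hi] at h1
  rw [jetHom_X, ← Polynomial.coeff_map, h1, coeff_jetPoly, dif_pos j.2]

theorem ker_constantCoeff_comp_jetHom (hle : ∀ i, lam i ≤ m + 1) [IsFractionRing (MvPolynomial
    {p : Fin n × Fin (m + 1) // lam p.1 ≤ (p.2 : ℕ)} k) K] :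
    RingHom.ker ((constantCoeff (R := K) (σ := Σ i : Fin n, Fin (lam i))).comp
      (jetHom k K m lam)) = Ideal.span {q | ∃ (i : Fin n) (j : Fin (m + 1)),
        (j : ℕ) < lam i ∧ q = X (i, j)} := by
  let ρ : MvPolynomial (Fin n × Fin (m + 1)) k →+*
      MvPolynomial {p : Fin n × Fin (m + 1) // lam p.1 ≤ (p.2 : ℕ)} k :=
    eval₂Hom C (fun p ↦ if h : lam p.1 ≤ (p.2 : ℕ) then X ⟨p, h⟩ else 0)
  have hρ : (constantCoeff (R := K) (σ := Σ i : Fin n, Fin (lam i))).comp (jetHom k K m lam) =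
      (algebraMap _ K).comp ρ := by
    ext p
    · simp [jetHom_C, ρ]
    · obtain ⟨i, j⟩ := p
      rw [RingHom.comp_apply, RingHom.comp_apply, constantCoeff_jetHom_X (hle i)]
      simp only [ρ, eval₂Hom_X']
      split_ifs <;> simp
  apply le_antisymm
  · intro r hr
    rw [RingHom.mem_ker, hρ, RingHom.comp_apply] at hr
    have hr0 : ρ r = 0 := (IsFractionRing.injective _ K) (hr.trans (map_zero _).symm)
    set 𝔭 : Ideal (MvPolynomial (Fin n × Fin (m + 1)) k) := Ideal.span {q | ∃ (i : Fin n)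
      (j : Fin (m + 1)), (j : ℕ) < lam i ∧ q = X (i, j)}
    have h : Ideal.Quotient.mk 𝔭 = ((Ideal.Quotient.mk 𝔭).comp
        (rename Subtype.val : MvPolynomial {p : Fin n × Fin (m + 1) // lam p.1 ≤ (p.2 : ℕ)} k →ₐ[k]
          MvPolynomial (Fin n × Fin (m + 1)) k).toRingHom).comp ρ := by
      ext p
      · simp [ρ]
      · simp only [ρ, RingHom.comp_apply, eval₂Hom_X']
        split_ifs with hp
        · simp
        · rw [map_zero, map_zero, Ideal.Quotient.eq_zero_iff_mem]
          exact Ideal.subset_span ⟨p.1, p.2, not_le.mp hp, rfl⟩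
    rw [← Ideal.Quotient.eq_zero_iff_mem, h, RingHom.comp_apply, hr0, map_zero]
  · rw [Ideal.span_le]
    rintro _ ⟨i, j, hj, rfl⟩
    rw [SetLike.mem_coe, RingHom.mem_ker, RingHom.comp_apply, constantCoeff_jetHom_X (hle i),
      dif_neg (not_le.mpr hj)]

theorem rename_jetHom (σ : Equiv.Perm (Σ i : Fin n, Fin (lam i))) (hσ : ∀ x, (σ x).1 = x.1)
    (r : MvPolynomial (Fin n × Fin (m + 1)) k) :
    rename σ (jetHom k K m lam r) = jetHom k K m lam r := by
  have hF : ∀ i, (jetFactor k K m lam i).map (rename σ : MvPolynomial (Σ i : Fin n, Fin (lam i)) K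
      →ₐ[K] MvPolynomial (Σ i : Fin n, Fin (lam i)) K).toRingHom = jetFactor k K m lam i := by
    intro i
    rw [map_jetFactor, jetFactor]
    refine congrArg₂ (· * ·) (congrArg (fun y ↦ unitPoly y i) (funext fun p ↦ by simp)) ?_
    · have hprod : ∀ f : (Σ i : Fin n, Fin (lam i)) →
          Polynomial (MvPolynomial (Σ i : Fin n, Fin (lam i)) K),
          ∏ j, f ⟨i, j⟩ = ∏ x, if x.1 = i then f x else 1 := by
        intro f
        rw [Fintype.prod_sigma, Finset.prod_eq_single i (fun b _ hb ↦ by simp [hb]) (by simp)]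
        simp
      rw [hprod fun x ↦ Polynomial.X - Polynomial.C (X x), hprod fun x ↦ Polynomial.X -
        Polynomial.C ((rename σ : MvPolynomial (Σ i : Fin n, Fin (lam i)) K
          →ₐ[K] MvPolynomial (Σ i : Fin n, Fin (lam i)) K).toRingHom (X x))]
      exact Fintype.prod_equiv σ _ _ fun x ↦ by simp [hσ]
  have h : (rename σ : MvPolynomial (Σ i : Fin n, Fin (lam i)) K →ₐ[K]
      MvPolynomial (Σ i : Fin n, Fin (lam i)) K).toRingHom.comp (jetHom k K m lam) =
      jetHom k K m lam := by
    refine MvPolynomial.ringHom_ext (fun a ↦ by simp [jetHom_C]) fun p ↦ ?_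
    · rw [RingHom.comp_apply, jetHom_X, ← Polynomial.coeff_map, hF]
  exact congrArg (fun f ↦ f r) h

theorem X_pow_dvd_prod_jetPoly_mk_jetHom (hlam : ∑ i, lam i = m + 1)
    {I : Ideal (MvPolynomial (Σ i : Fin n, Fin (lam i)) K)}
    (hI : I = Ideal.span {q | q.IsSymmetric ∧ constantCoeff q = 0}) :
    Polynomial.X ^ (m + 1) ∣ ∏ i, jetPoly m (lam i)
      (fun j ↦ Ideal.Quotient.mk I (jetHom k K m lam (X (i, j)))) := by
  have hle : ∀ i, lam i ≤ m + 1 := fun i ↦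
    hlam ▸ Finset.single_le_sum (fun _ _ ↦ Nat.zero_le _) (Finset.mem_univ i)
  have h1 : ∀ i, jetPoly m (lam i) (fun j ↦ Ideal.Quotient.mk I (jetHom k K m lam (X (i, j)))) =
      (jetFactor k K m lam i).map (Ideal.Quotient.mk I) := fun i ↦ by
    rw [← jetPoly_jetHom (hle i), map_jetPoly]
  have h2 := prod_X_sub_C_quotient_eq hI
  rw [Fintype.prod_sigma, Fintype.card_sigma] at h2
  simp only [Fintype.card_fin, hlam] at h2
  rw [Finset.prod_congr rfl fun i _ ↦ h1 i, Finset.prod_congr rfl fun i _ ↦ map_jetFactor _ i,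
    Finset.prod_mul_distrib, h2]
  exact Dvd.intro_left _ rfl

end JetHom

section JetLocalization

variable {k K B : Type*} [Field k] [Field K] [CommRing B] {n m : ℕ} {lam : Fin n → ℕ}
  [Algebra (MvPolynomial {p : Fin n × Fin (m + 1) // lam p.1 ≤ (p.2 : ℕ)} k) K]

theorem le_of_sum_eq (hlam : ∑ i, lam i = m + 1) (i : Fin n) : lam i ≤ m + 1 :=
  hlam ▸ Finset.single_le_sum (fun _ _ ↦ Nat.zero_le _) (Finset.mem_univ i)

theorem Polynomial.monic_prod_X_sub_C_block {T : Type*} [CommRing T] {l : ℕ} (z : Fin l → T) :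
    (∏ j, (Polynomial.X - Polynomial.C (z j))).Monic :=
  Polynomial.monic_prod_of_monic _ _ fun _ _ ↦ Polynomial.monic_X_sub_C _

theorem Polynomial.natDegree_prod_X_sub_C_block {T : Type*} [CommRing T] [Nontrivial T] {l : ℕ}
    (z : Fin l → T) : (∏ j, (Polynomial.X - Polynomial.C (z j))).natDegree = l := by
  rw [Polynomial.natDegree_prod_of_monic _ _ fun j _ ↦ Polynomial.monic_X_sub_C _]
  simp

theorem map_factors_eq {I : Ideal (MvPolynomial (Σ i : Fin n, Fin (lam i)) K)}
    (hle : ∀ i, lam i ≤ m + 1)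
    [IsFractionRing (MvPolynomial {p : Fin n × Fin (m + 1) // lam p.1 ≤ (p.2 : ℕ)} k) K]
    {β : MvPolynomial (Fin n × Fin (m + 1)) k →+* B}
    {ψ : B →+* MvPolynomial (Σ i : Fin n, Fin (lam i)) K ⧸ I}
    (hψ : ψ.comp β = (Ideal.Quotient.mk I).comp (jetHom k K m lam))
    {u g : Fin n → Polynomial B}
    (hug : ∀ i, jetPoly m (lam i) (fun j ↦ β (X (i, j))) = u i * g i) (hg : ∀ i, (g i).Monic)
    (hgd : ∀ i, (g i).natDegree = lam i)
    (hgn : ∀ i, ∀ j < lam i, IsNilpotent ((g i).coeff j)) (i : Fin n) :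
    unitPoly (fun p : {p : Fin n × Fin (m + 1) // lam p.1 ≤ (p.2 : ℕ)} ↦
        Ideal.Quotient.mk I (C (algebraMap (MvPolynomial {p : Fin n × Fin (m + 1) //
          lam p.1 ≤ (p.2 : ℕ)} k) K (X p)))) i = (u i).map ψ ∧
      ∏ j : Fin (lam i), (Polynomial.X - Polynomial.C (Ideal.Quotient.mk I (X ⟨i, j⟩))) =
        (g i).map ψ := by
  nontriviality (MvPolynomial (Σ i : Fin n, Fin (lam i)) K ⧸ I)
  have hgd' : ((g i).map ψ).natDegree = lam i := by rw [(hg i).natDegree_map, hgd]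
  refine Polynomial.factorization_unique_of_coeff_isNilpotent
    (isUnit_coeff_zero_unitPoly (hle i) fun p ↦ ?_)
    (Polynomial.monic_prod_X_sub_C_block _) ((hg i).map ψ)
    ((Polynomial.natDegree_prod_X_sub_C_block _).trans hgd'.symm) (fun j hj ↦ ?_) ?_
  · refine IsUnit.map _ (IsUnit.map _ (isUnit_iff_ne_zero.mpr fun h ↦ X_ne_zero p
      (IsFractionRing.injective _ K (h.trans (map_zero _).symm))))
  · rw [Polynomial.coeff_map]
    exact (hgn i j (hgd' ▸ hj)).map ψ
  · rw [← map_jetFactor, ← Polynomial.map_mul, ← hug, map_jetPoly, ← jetPoly_jetHom (hle i),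
      map_jetPoly]
    exact congrArg _ (funext fun j ↦ (congrArg (fun f ↦ f (X (i, j))) hψ).symm)

theorem exists_coefficient_hom [IsLocalRing B]
    [IsFractionRing (MvPolynomial {p : Fin n × Fin (m + 1) // lam p.1 ≤ (p.2 : ℕ)} k) K]
    {I : Ideal (MvPolynomial (Σ i : Fin n, Fin (lam i)) K)} (hI : I ≠ ⊤)
    (hnil : IsNilpotent (IsLocalRing.maximalIdeal B))
    {β : MvPolynomial (Fin n × Fin (m + 1)) k →+* B}
    {ψ : B →+* MvPolynomial (Σ i : Fin n, Fin (lam i)) K ⧸ I}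
    (hψ : ψ.comp β = (Ideal.Quotient.mk I).comp (jetHom k K m lam))
    {u : Fin n → Polynomial B}
    (hu : ∀ i, unitPoly (fun p : {p : Fin n × Fin (m + 1) // lam p.1 ≤ (p.2 : ℕ)} ↦
        Ideal.Quotient.mk I (C (algebraMap (MvPolynomial {p : Fin n × Fin (m + 1) //
          lam p.1 ≤ (p.2 : ℕ)} k) K (X p)))) i = (u i).map ψ) :
    ∃ χ : K →+* B, ψ.comp χ = (Ideal.Quotient.mk I).comp C ∧
      (∀ a : k, χ (algebraMap (MvPolynomial {p : Fin n × Fin (m + 1) //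
        lam p.1 ≤ (p.2 : ℕ)} k) K (C a)) = β (C a)) ∧
      ∀ p : {p : Fin n × Fin (m + 1) // lam p.1 ≤ (p.2 : ℕ)},
        χ (algebraMap (MvPolynomial {p : Fin n × Fin (m + 1) // lam p.1 ≤ (p.2 : ℕ)} k) K (X p)) =
          (u p.1.1).coeff (p.1.2 - lam p.1.1) := by
  have : Nontrivial (MvPolynomial (Σ i : Fin n, Fin (lam i)) K ⧸ I) :=
    Ideal.Quotient.nontrivial_iff.mpr hI
  let χ₀ : MvPolynomial {p : Fin n × Fin (m + 1) // lam p.1 ≤ (p.2 : ℕ)} k →+* B :=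
    eval₂Hom (β.comp C) (fun p ↦ (u p.1.1).coeff (p.1.2 - lam p.1.1))
  have hχ₀ : ψ.comp χ₀ = ((Ideal.Quotient.mk I).comp C).comp (algebraMap _ K) := by
    refine MvPolynomial.ringHom_ext (fun a ↦ ?_) fun p ↦ ?_
    · have := congrArg (fun f ↦ f (C a)) hψ
      simp only [RingHom.comp_apply, jetHom_C] at this
      simp [χ₀, this]
    · simp only [χ₀, RingHom.comp_apply, eval₂Hom_X']
      rw [← Polynomial.coeff_map, ← hu, coeff_unitPoly,
        dif_pos (by have := p.1.2.2; have := p.2; omega)]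
      congr 5
      have := p.2
      ext <;> simp
      omega
  have hunit : ∀ p : nonZeroDivisors (MvPolynomial {p : Fin n × Fin (m + 1) //
      lam p.1 ≤ (p.2 : ℕ)} k), IsUnit (χ₀ p) := by
    intro p
    by_contra h
    have hm := (IsLocalRing.mem_maximalIdeal _).mpr h
    obtain ⟨N, hN⟩ := hnil
    have h0 : χ₀ p ^ N = 0 := by
      have := Ideal.pow_mem_pow hm N
      rwa [hN] at this
    have h1 : IsUnit (ψ (χ₀ p)) := by
      rw [← RingHom.comp_apply, hχ₀]
      exact IsUnit.map ((Ideal.Quotient.mk I).comp C) (IsLocalization.map_units K p)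
    exact (h1.pow N).ne_zero (by rw [← map_pow, h0, map_zero])
  refine ⟨IsLocalization.lift hunit, ?_, fun a ↦ ?_, fun p ↦ ?_⟩
  · refine IsLocalization.ringHom_ext (nonZeroDivisors (MvPolynomial {p : Fin n × Fin (m + 1) //
      lam p.1 ≤ (p.2 : ℕ)} k)) ?_
    rw [RingHom.comp_assoc, IsLocalization.lift_comp, hχ₀]
  · rw [IsLocalization.lift_eq]
    simp [χ₀]
  · rw [IsLocalization.lift_eq]
    simp [χ₀]

theorem injective_of_factors.{u} {B : Type u} [CommRing B] (hlam : ∑ i, lam i = m + 1)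
    {I : Ideal (MvPolynomial (Σ i : Fin n, Fin (lam i)) K)}
    (hI : I = Ideal.span {q | q.IsSymmetric ∧ constantCoeff q = 0})
    {β : MvPolynomial (Fin n × Fin (m + 1)) k →+* B}
    (hepi : ∀ (T : Type u) [CommRing T] (f g : B →+* T), f.comp β = g.comp β → f = g)
    {ψ : B →+* MvPolynomial (Σ i : Fin n, Fin (lam i)) K ⧸ I}
    (hψ : ψ.comp β = (Ideal.Quotient.mk I).comp (jetHom k K m lam))
    {u g : Fin n → Polynomial B}
    (hug : ∀ i, jetPoly m (lam i) (fun j ↦ β (X (i, j))) = u i * g i) (hg : ∀ i, (g i).Monic)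
    (hgd : ∀ i, (g i).natDegree = lam i) (hprod : ∏ i, g i = Polynomial.X ^ (m + 1))
    {χ : K →+* B}
    (hχC : ∀ a : k, χ (algebraMap (MvPolynomial {p : Fin n × Fin (m + 1) //
        lam p.1 ≤ (p.2 : ℕ)} k) K (C a)) = β (C a))
    (hχX : ∀ p : {p : Fin n × Fin (m + 1) // lam p.1 ≤ (p.2 : ℕ)},
        χ (algebraMap (MvPolynomial {p : Fin n × Fin (m + 1) // lam p.1 ≤ (p.2 : ℕ)} k) K (X p)) =
          (u p.1.1).coeff (p.1.2 - lam p.1.1)) : Function.Injective ψ := by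
  obtain ⟨B', _, φ, hφ, z, hz⟩ := Polynomial.exists_injective_forall_map_eq_prod g hg lam hgd
  let θ : MvPolynomial (Σ i : Fin n, Fin (lam i)) K →+* B' := eval₂Hom (φ.comp χ) z
  have hθC : ∀ a, θ (C a) = φ (χ a) := fun a ↦ by simp [θ]
  have hθX : ∀ x, θ (X x) = z x := fun x ↦ by simp [θ]
  have hθprod : ∏ x, (Polynomial.X - Polynomial.C (θ (X x))) =
      Polynomial.X ^ Fintype.card (Σ i : Fin n, Fin (lam i)) := by
    rw [Fintype.prod_sigma, Fintype.card_sigma]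
    simp only [Fintype.card_fin, hlam, hθX]
    rw [← Finset.prod_congr rfl fun i _ ↦ hz i, ← Polynomial.map_prod, hprod, Polynomial.map_pow,
      Polynomial.map_X]
  have hθI : ∀ q ∈ I, θ q = 0 := by
    have : I ≤ RingHom.ker θ := by
      rw [hI, Ideal.span_le]
      exact fun q hq ↦ hq.1.map_eq_zero θ hθprod hq.2
    exact this
  have hcomp : (Ideal.Quotient.lift I θ hθI).comp ψ = φ := by
    refine hepi _ _ _ ?_
    rw [RingHom.comp_assoc, hψ, ← RingHom.comp_assoc, Ideal.Quotient.lift_comp_mk]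
    refine MvPolynomial.ringHom_ext (fun a ↦ ?_) fun p ↦ ?_
    · rw [RingHom.comp_apply, jetHom_C, hθC, hχC, RingHom.comp_apply]
    · obtain ⟨i, j⟩ := p
      rw [RingHom.comp_apply, jetHom_X, ← Polynomial.coeff_map, map_jetFactor]
      simp only [hθC, hθX]
      rw [← hz i, ← map_unitPoly, ← Polynomial.map_mul,
        ← eq_unitPoly_of_mul_eq_jetPoly (le_of_sum_eq hlam i) (hg i) (hgd i) (hug i)
          (fun p hp ↦ by rw [hχX, hp]), ← hug, Polynomial.coeff_map, coeff_jetPoly,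
        dif_pos j.2, RingHom.comp_apply]
  refine Function.Injective.of_comp (f := Ideal.Quotient.lift I θ hθI) ?_
  rw [← RingHom.coe_comp, hcomp]
  exact hφ

theorem mk_mem_range_of_factors [CharZero K]
    {I : Ideal (MvPolynomial (Σ i : Fin n, Fin (lam i)) K)}
    {ψ : B →+* MvPolynomial (Σ i : Fin n, Fin (lam i)) K ⧸ I} {g : Fin n → Polynomial B}
    (hg : ∀ i, ∏ j : Fin (lam i), (Polynomial.X - Polynomial.C (Ideal.Quotient.mk I (X ⟨i, j⟩))) =
        (g i).map ψ) {χ : K →+* B} (hχ : ψ.comp χ = (Ideal.Quotient.mk I).comp C)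
    {p : MvPolynomial (Σ i : Fin n, Fin (lam i)) K}
    (hp : ∀ σ : Equiv.Perm (Σ i : Fin n, Fin (lam i)), (∀ x, (σ x).1 = x.1) → rename σ p = p) :
    Ideal.Quotient.mk I p ∈ ψ.range := by
  have hmem := mem_adjoin_rename_esymm lam p hp
  clear hp
  induction hmem using Algebra.adjoin_induction with
  | mem q hq =>
    obtain ⟨i, r, hr, rfl⟩ := hq
    rw [esymm_eq_coeff_prod_X_sub_C (by simpa using hr)]
    have h : ((∏ j : Fin (lam i), (Polynomial.X - Polynomial.C (X j : MvPolynomial (Fin (lam i)) K))).map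
        ((Ideal.Quotient.mk I).comp (rename (fun j ↦ ⟨i, j⟩) : MvPolynomial (Fin (lam i)) K →ₐ[K]
          MvPolynomial (Σ i : Fin n, Fin (lam i)) K).toRingHom)) = (g i).map ψ := by
      rw [← hg, Polynomial.map_prod]
      simp
    refine ⟨(-1) ^ r * (g i).coeff (Fintype.card (Fin (lam i)) - r), ?_⟩
    rw [map_mul, ← Polynomial.coeff_map, ← h, Polynomial.coeff_map]
    simp
  | algebraMap a => exact ⟨χ a, congrArg (fun f ↦ f a) hχ⟩
  | add p q _ _ hp hq => exact map_add (Ideal.Quotient.mk I) p q ▸ add_mem hp hq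
  | mul p q _ _ hp hq => exact map_mul (Ideal.Quotient.mk I) p q ▸ mul_mem hp hq

theorem mem_map_of_mul_eq {σ : Type*} [Fintype σ] {I : Ideal (MvPolynomial σ K)}
    (hI : I = Ideal.span {q | q.IsSymmetric ∧ constantCoeff q = 0})
    {S : Subalgebra K (MvPolynomial σ K)} {b : MvPolynomial σ K ⧸ I} {r s : MvPolynomial σ K}
    (hr : r ∈ S) (hs : s ∈ S) (h0 : constantCoeff s ≠ 0)
    (h : b * Ideal.Quotient.mk I s = Ideal.Quotient.mk I r) :
    b ∈ S.map (Ideal.Quotient.mkₐ K I) := by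
  set A := S.map (Ideal.Quotient.mkₐ K I) with hA
  have hrA : Ideal.Quotient.mk I r ∈ A := ⟨r, hr, rfl⟩
  have hsA : Ideal.Quotient.mk I s ∈ A := ⟨s, hs, rfl⟩
  have hnil : IsNilpotent ((⟨_, hsA⟩ : A) - algebraMap K A (constantCoeff s)) := by
    refine (isNilpotent_mk_of_constantCoeff_eq_zero hI (p := s - C (constantCoeff s))
      (by simp)).imp fun N hN ↦ ?_
    apply Subtype.ext
    rw [map_sub] at hN
    exact hN
  have hu : IsUnit (⟨_, hsA⟩ : A) := by
    have := hnil.isUnit_add_left_of_commute (((isUnit_iff_ne_zero.mpr h0).map (algebraMap K A)))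
      (Commute.all _ _)
    simpa using this
  obtain ⟨a, ha⟩ := hu.exists_right_inv
  have ha' : Ideal.Quotient.mk I s * a = 1 := congrArg Subtype.val ha
  have : b = Ideal.Quotient.mk I r * a := by rw [← h, mul_assoc, ha', mul_one]
  rw [this]
  exact A.mul_mem hrA a.2

theorem injective_and_mem_range_iff.{u} {B : Type u} [CommRing B] [IsLocalRing B]
    [IsNoetherianRing B] [CharZero K]
    [IsFractionRing (MvPolynomial {p : Fin n × Fin (m + 1) // lam p.1 ≤ (p.2 : ℕ)} k) K]
    (hlam : ∑ i, lam i = m + 1)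
    {I : Ideal (MvPolynomial (Σ i : Fin n, Fin (lam i)) K)}
    (hI : I = Ideal.span {q | q.IsSymmetric ∧ constantCoeff q = 0})
    {S : Subalgebra K (MvPolynomial (Σ i : Fin n, Fin (lam i)) K)}
    (hS : ∀ p, p ∈ S ↔ ∀ σ : Equiv.Perm (Σ i : Fin n, Fin (lam i)),
      (∀ x, (σ x).1 = x.1) → rename σ p = p)
    {β : MvPolynomial (Fin n × Fin (m + 1)) k →+* B}
    (hJ : Polynomial.X ^ (m + 1) ∣ ∏ i, jetPoly m (lam i) (fun j ↦ β (X (i, j))))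
    (hunit : ∀ i (j : Fin (m + 1)), lam i ≤ (j : ℕ) → IsUnit (β (X (i, j))))
    (hmax : IsLocalRing.maximalIdeal B =
      Ideal.span {b | ∃ (i : Fin n) (j : Fin (m + 1)), (j : ℕ) < lam i ∧ b = β (X (i, j))})
    (hepi : ∀ (T : Type u) [CommRing T] (f g : B →+* T), f.comp β = g.comp β → f = g)
    (hfrac : ∀ b, ∃ r s, IsUnit (β s) ∧ b * β s = β r)
    {ψ : B →+* MvPolynomial (Σ i : Fin n, Fin (lam i)) K ⧸ I}
    (hψ : ψ.comp β = (Ideal.Quotient.mk I).comp (jetHom k K m lam)) :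
    Function.Injective ψ ∧ ∀ q, q ∈ ψ.range ↔ q ∈ S.map (Ideal.Quotient.mkₐ K I) := by
  have hIle : I ≤ RingHom.ker (constantCoeff (R := K) (σ := Σ i : Fin n, Fin (lam i))) := by
    rw [hI, Ideal.span_le]
    exact fun q hq ↦ hq.2
  have hI0 : ∀ q ∈ I, constantCoeff q = 0 := hIle
  have hIne : I ≠ ⊤ := fun h ↦ by
    have : (1 : MvPolynomial (Σ i : Fin n, Fin (lam i)) K) ∈ I := h ▸ Submodule.mem_top
    simpa using hIle this
  obtain ⟨hnil, u, g, hug, hg, hgd, hgn, hprod⟩ :=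
    exists_factorization_jetPoly hlam hJ hunit hmax
  have hfac := map_factors_eq (le_of_sum_eq hlam) hψ hug hg hgd hgn
  obtain ⟨χ, hχ, hχC, hχX⟩ := exists_coefficient_hom hIne hnil hψ fun i ↦ (hfac i).1
  refine ⟨injective_of_factors hlam hI hepi hψ hug hg hgd hprod hχC hχX, fun q ↦ ⟨?_, ?_⟩⟩
  · rintro ⟨b, rfl⟩
    obtain ⟨r, s, hs, hb⟩ := hfrac b
    have hψβ : ∀ r, ψ (β r) = Ideal.Quotient.mk I (jetHom k K m lam r) :=
      fun r ↦ congrArg (fun f ↦ f r) hψ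
    have hmem : ∀ r, jetHom k K m lam r ∈ S := fun r ↦
      (hS _).mpr fun σ hσ ↦ rename_jetHom σ hσ r
    refine mem_map_of_mul_eq hI (hmem r) (hmem s) (fun h0 ↦ ?_)
      (by rw [← hψβ, ← hψβ, ← map_mul, hb])
    have h1 := (hs.map ψ).map (Ideal.Quotient.lift I constantCoeff hI0)
    rw [hψβ, Ideal.Quotient.lift_mk, h0] at h1
    exact h1.ne_zero rfl
  · rintro ⟨p, hp, rfl⟩
    exact mk_mem_range_of_factors (fun i ↦ (hfac i).2) hχ ((hS p).mp hp)

theorem exists_hom_comp_algebraMap_eq [IsFractionRing (MvPolynomial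
    {p : Fin n × Fin (m + 1) // lam p.1 ≤ (p.2 : ℕ)} k) K]
    (hlam : ∑ i, lam i = m + 1) {I : Ideal (MvPolynomial (Σ i : Fin n, Fin (lam i)) K)}
    (hI : I = Ideal.span {q | q.IsSymmetric ∧ constantCoeff q = 0})
    {J 𝔭 : Ideal (MvPolynomial (Fin n × Fin (m + 1)) k)}
    (hJ : ∀ r ∈ J, Ideal.Quotient.mk I (jetHom k K m lam r) = 0)
    (hJp : J ≤ 𝔭)
    (h𝔭 : 𝔭 = Ideal.span {q | ∃ (i : Fin n) (j : Fin (m + 1)), (j : ℕ) < lam i ∧ q = X (i, j)})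
    [(𝔭.map (Ideal.Quotient.mk J)).IsPrime]
    [Algebra (MvPolynomial (Fin n × Fin (m + 1)) k ⧸ J) B]
    [IsLocalization.AtPrime B (𝔭.map (Ideal.Quotient.mk J))] :
    ∃ ψ : B →+* MvPolynomial (Σ i : Fin n, Fin (lam i)) K ⧸ I,
      ψ.comp ((algebraMap _ B).comp (Ideal.Quotient.mk J)) =
        (Ideal.Quotient.mk I).comp (jetHom k K m lam) := by
  have hmem : ∀ r, Ideal.Quotient.mk J r ∈ 𝔭.map (Ideal.Quotient.mk J) ↔ r ∈ 𝔭 := fun r ↦ by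
    rw [Ideal.mem_map_iff_of_surjective _ Ideal.Quotient.mk_surjective]
    refine ⟨fun ⟨s, hs, h⟩ ↦ ?_, fun h ↦ ⟨r, h, rfl⟩⟩
    have := 𝔭.sub_mem hs (hJp (Ideal.Quotient.eq.mp h))
    simpa using this
  have hunit : ∀ y : (𝔭.map (Ideal.Quotient.mk J)).primeCompl, IsUnit
      (Ideal.Quotient.lift J ((Ideal.Quotient.mk I).comp (jetHom k K m lam)) hJ y) := by
    rintro ⟨y, hy⟩
    obtain ⟨r, rfl⟩ := Ideal.Quotient.mk_surjective y
    rw [Ideal.Quotient.lift_mk, RingHom.comp_apply]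
    have hr : constantCoeff (jetHom k K m lam r) ≠ 0 := fun h ↦ by
      refine hy ((hmem r).mpr ?_)
      rw [h𝔭, ← ker_constantCoeff_comp_jetHom (K := K) (le_of_sum_eq hlam)]
      exact h
    have hnil := isNilpotent_mk_of_constantCoeff_eq_zero hI
      (p := jetHom k K m lam r - C (constantCoeff (jetHom k K m lam r))) (by simp)
    have := hnil.isUnit_add_left_of_commute ((isUnit_iff_ne_zero.mpr hr).map
      ((Ideal.Quotient.mk I).comp C)) (Commute.all _ _)
    rw [RingHom.comp_apply, ← map_add] at this
    simpa using this
  exact ⟨IsLocalization.lift hunit, by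
    rw [← RingHom.comp_assoc, IsLocalization.lift_comp, Ideal.Quotient.lift_comp_mk]⟩


theorem X_pow_dvd_prod_jetPoly_iff_forall_mem {k T : Type*} [CommRing k] [CommRing T] {n m : ℕ}
    (lam : Fin n → ℕ) {P : Polynomial (MvPolynomial (Fin n × Fin (m + 1)) k)}
    (hP : P = ∏ i : Fin n, ∑ j : Fin (m + 1),
      Polynomial.C (X (i, j)) * Polynomial.X ^ (j : ℕ))
    {J : Ideal (MvPolynomial (Fin n × Fin (m + 1)) k)}
    (hJ : J = Ideal.span {q | ∃ d ≤ m, q = P.coeff d})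
    (f : MvPolynomial (Fin n × Fin (m + 1)) k →+* T) :
    Polynomial.X ^ (m + 1) ∣ ∏ i, jetPoly m (lam i) (fun j ↦ f (X (i, j))) ↔
      ∀ r ∈ J, f r = 0 := by
  have hPf : ∏ i, ∑ j : Fin (m + 1), Polynomial.C (f (X (i, j))) * Polynomial.X ^ (j : ℕ) =
      P.map f := by
    simp [hP, Polynomial.map_prod, Polynomial.map_sum]
  rw [X_pow_dvd_prod_jetPoly_iff, hPf, Polynomial.X_pow_dvd_iff]
  simp only [Polynomial.coeff_map]
  constructor
  · intro h
    have : J ≤ RingHom.ker f := by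
      rw [hJ, Ideal.span_le]
      rintro _ ⟨d, hd, rfl⟩
      exact h d (Nat.lt_succ_of_le hd)
    exact this
  · exact fun h d hd ↦ h _ (hJ ▸ Ideal.subset_span ⟨d, Nat.le_of_lt_succ hd, rfl⟩)

theorem nonempty_ringEquiv_of_isLocalization.{u} {k K : Type*} {B : Type u} [Field k]
    [Field K] [CommRing B]
    [CharZero K] {n m : ℕ} {lam : Fin n → ℕ}
    [Algebra (MvPolynomial {p : Fin n × Fin (m + 1) // lam p.1 ≤ (p.2 : ℕ)} k) K]
    [IsFractionRing (MvPolynomial {p : Fin n × Fin (m + 1) // lam p.1 ≤ (p.2 : ℕ)} k) K]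
    (hlam : ∑ i, lam i = m + 1) {P : Polynomial (MvPolynomial (Fin n × Fin (m + 1)) k)}
    (hP : P = ∏ i : Fin n, ∑ j : Fin (m + 1),
      Polynomial.C (X (i, j)) * Polynomial.X ^ (j : ℕ))
    {J 𝔭 : Ideal (MvPolynomial (Fin n × Fin (m + 1)) k)}
    (hJ : J = Ideal.span {q | ∃ d ≤ m, q = P.coeff d})
    (h𝔭 : 𝔭 = Ideal.span {q | ∃ (i : Fin n) (j : Fin (m + 1)), (j : ℕ) < lam i ∧ q = X (i, j)})
    {I : Ideal (MvPolynomial (Σ i : Fin n, Fin (lam i)) K)}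
    (hI : I = Ideal.span {q | q.IsSymmetric ∧ constantCoeff q = 0})
    {S : Subalgebra K (MvPolynomial (Σ i : Fin n, Fin (lam i)) K)}
    [(𝔭.map (Ideal.Quotient.mk J)).IsPrime]
    [Algebra (MvPolynomial (Fin n × Fin (m + 1)) k ⧸ J) B]
    [IsLocalization.AtPrime B (𝔭.map (Ideal.Quotient.mk J))] (hJp : J ≤ 𝔭)
    (hJI : ∀ r ∈ J, Ideal.Quotient.mk I (jetHom k K m lam r) = 0)
    (hS : ∀ p, p ∈ S ↔ ∀ σ : Equiv.Perm (Σ i : Fin n, Fin (lam i)),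
      (∀ x, (σ x).1 = x.1) → rename σ p = p) :
    Nonempty (B ≃+* S.map (Ideal.Quotient.mkₐ K I)) := by
  have hle := le_of_sum_eq hlam
  have hker := ker_constantCoeff_comp_jetHom (k := k) (K := K) hle
  rw [← h𝔭] at hker
  obtain ⟨ψ, hψ⟩ := exists_hom_comp_algebraMap_eq (B := B) hlam hI hJI hJp h𝔭
  have : IsLocalRing B := IsLocalization.AtPrime.isLocalRing B (𝔭.map (Ideal.Quotient.mk J))
  set β : MvPolynomial (Fin n × Fin (m + 1)) k →+* B :=
    (algebraMap _ B).comp (Ideal.Quotient.mk J) with hβ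
  have hunit : ∀ r, r ∉ 𝔭 → IsUnit (β r) := fun r hr ↦ by
    refine IsLocalization.map_units B (⟨Ideal.Quotient.mk J r, fun h ↦ hr ?_⟩ :
      (𝔭.map (Ideal.Quotient.mk J)).primeCompl)
    have := Ideal.mem_comap.mpr h
    rwa [Ideal.comap_map_of_surjective _ Ideal.Quotient.mk_surjective, ← RingHom.ker_eq_comap_bot,
      Ideal.mk_ker, sup_eq_left.mpr hJp] at this
  have : IsNoetherianRing B := IsLocalization.isNoetherianRing
    (𝔭.map (Ideal.Quotient.mk J)).primeCompl B inferInstance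
  have hdvd : Polynomial.X ^ (m + 1) ∣ ∏ i, jetPoly m (lam i) (fun j ↦ β (X (i, j))) :=
    (X_pow_dvd_prod_jetPoly_iff_forall_mem lam hP hJ β).mpr fun r hr ↦ by
      rw [hβ, RingHom.comp_apply, Ideal.Quotient.eq_zero_iff_mem.mpr hr, map_zero]
  have hX : ∀ i (j : Fin (m + 1)), lam i ≤ (j : ℕ) → IsUnit (β (X (i, j))) := fun i j hij ↦
    hunit _ fun h ↦ by
      rw [← hker, RingHom.mem_ker, RingHom.comp_apply, constantCoeff_jetHom_X (hle i),
        dif_pos hij] at h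
      exact X_ne_zero _ (IsFractionRing.injective _ K (h.trans (map_zero _).symm))
  have hmax : IsLocalRing.maximalIdeal B =
      Ideal.span {b | ∃ (i : Fin n) (j : Fin (m + 1)), (j : ℕ) < lam i ∧ b = β (X (i, j))} := by
    have h : 𝔭.map β = IsLocalRing.maximalIdeal B := by
      rw [hβ, ← Ideal.map_map]
      exact IsLocalization.AtPrime.map_eq_maximalIdeal (𝔭.map (Ideal.Quotient.mk J)) B
    rw [← h, h𝔭, Ideal.map_span]
    congr 1
    ext b
    constructor
    · rintro ⟨_, ⟨i, j, hij, rfl⟩, rfl⟩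
      exact ⟨i, j, hij, rfl⟩
    · rintro ⟨i, j, hij, rfl⟩
      exact ⟨_, ⟨i, j, hij, rfl⟩, rfl⟩
  have hepi : ∀ (T : Type u) [CommRing T] (f g : B →+* T), f.comp β = g.comp β → f = g :=
    fun T _ f g hfg ↦ IsLocalization.ringHom_ext (𝔭.map (Ideal.Quotient.mk J)).primeCompl
      (Ideal.Quotient.ringHom_ext (by rw [RingHom.comp_assoc, hfg, RingHom.comp_assoc]))
  have hfrac : ∀ b, ∃ r s, IsUnit (β s) ∧ b * β s = β r := fun b ↦ by
    obtain ⟨⟨r, s⟩, hrs⟩ := IsLocalization.surj (𝔭.map (Ideal.Quotient.mk J)).primeCompl b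
    obtain ⟨r, rfl⟩ := Ideal.Quotient.mk_surjective r
    obtain ⟨t, ht⟩ := Ideal.Quotient.mk_surjective s.1
    refine ⟨r, t, ?_, ?_⟩
    · rw [hβ, RingHom.comp_apply, ht]
      exact IsLocalization.map_units B s
    · rw [hβ, RingHom.comp_apply, ht]
      exact hrs
  obtain ⟨hinj, hrange⟩ :=
    injective_and_mem_range_iff hlam hI hS hdvd hX hmax hepi hfrac hψ
  refine ⟨RingEquiv.ofBijective
    (ψ.codRestrict (S.map (Ideal.Quotient.mkₐ K I)) fun b ↦ (hrange _).mp ⟨b, rfl⟩)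
    ⟨fun a b hab ↦ hinj (congrArg Subtype.val hab), fun ⟨q, hq⟩ ↦ ?_⟩⟩
  obtain ⟨b, rfl⟩ := (hrange q).mpr hq
  exact ⟨b, rfl⟩

theorem nonempty_localization_ringEquiv.{u} {k : Type u} {K : Type*} [Field k] [Field K]
    [CharZero K] {n m : ℕ} {lam : Fin n → ℕ}
    [Algebra (MvPolynomial {p : Fin n × Fin (m + 1) // lam p.1 ≤ (p.2 : ℕ)} k) K]
    [IsFractionRing (MvPolynomial {p : Fin n × Fin (m + 1) // lam p.1 ≤ (p.2 : ℕ)} k) K]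
    (hlam : ∑ i, lam i = m + 1) {P : Polynomial (MvPolynomial (Fin n × Fin (m + 1)) k)}
    (hP : P = ∏ i : Fin n, ∑ j : Fin (m + 1),
      Polynomial.C (X (i, j)) * Polynomial.X ^ (j : ℕ))
    {J 𝔭 : Ideal (MvPolynomial (Fin n × Fin (m + 1)) k)}
    (hJ : J = Ideal.span {q | ∃ d ≤ m, q = P.coeff d})
    (h𝔭 : 𝔭 = Ideal.span {q | ∃ (i : Fin n) (j : Fin (m + 1)), (j : ℕ) < lam i ∧ q = X (i, j)})
    {I : Ideal (MvPolynomial (Σ i : Fin n, Fin (lam i)) K)}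
    (hI : I = Ideal.span {q | q.IsSymmetric ∧ constantCoeff q = 0})
    {S : Subalgebra K (MvPolynomial (Σ i : Fin n, Fin (lam i)) K)}
    (hS : ∀ p, p ∈ S ↔ ∀ σ : Equiv.Perm (Σ i : Fin n, Fin (lam i)),
      (∀ x, (σ x).1 = x.1) → rename σ p = p) :
    ∃ hp : (𝔭.map (Ideal.Quotient.mk J)).IsPrime,
      Nonempty (Localization (@Ideal.primeCompl _ _ (𝔭.map (Ideal.Quotient.mk J)) hp) ≃+*
        S.map (Ideal.Quotient.mkₐ K I)) := by
  have hle := le_of_sum_eq hlam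
  have hker := ker_constantCoeff_comp_jetHom (k := k) (K := K) hle
  rw [← h𝔭] at hker
  have hIle : I ≤ RingHom.ker (constantCoeff (R := K) (σ := Σ i : Fin n, Fin (lam i))) := by
    rw [hI, Ideal.span_le]
    exact fun q hq ↦ hq.2
  have h𝔭prime : 𝔭.IsPrime := hker ▸ RingHom.ker_isPrime _
  have hJI : ∀ r ∈ J, Ideal.Quotient.mk I (jetHom k K m lam r) = 0 :=
    (X_pow_dvd_prod_jetPoly_iff_forall_mem lam hP hJ
      ((Ideal.Quotient.mk I).comp (jetHom k K m lam))).mp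
      (X_pow_dvd_prod_jetPoly_mk_jetHom hlam hI)
  have hJp : J ≤ 𝔭 := fun r hr ↦ by
    rw [← hker]
    exact hIle (Ideal.Quotient.eq_zero_iff_mem.mp (hJI r hr))
  have hp : (𝔭.map (Ideal.Quotient.mk J)).IsPrime :=
    Ideal.map_isPrime_of_surjective Ideal.Quotient.mk_surjective (by rwa [Ideal.mk_ker])
  exact ⟨hp, nonempty_ringEquiv_of_isLocalization
    (B := Localization.AtPrime (𝔭.map (Ideal.Quotient.mk J)))
    hlam hP hJ h𝔭 hI hJp hJI hS⟩

end JetLocalization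

/-- Let `R_m = k[x_i^{(j)} : 1 ≤ i ≤ n, 0 ≤ j ≤ m]`,
`J_m(x_1⋯x_n)` the ideal generated by the coefficients of `t^0,…,t^m` in
`∏_i (x_i^{(0)} + x_i^{(1)} t + ⋯ + x_i^{(m)} t^m)`, and for
`λ = (λ_1,…,λ_n)` with `∑ λ_i = m + 1`, let `𝔭_λ` be the prime generated by the
`x_i^{(j)}` with `j < λ_i`, and `K_λ` the fraction field of the polynomial ring over `k`
in the remaining variables `x_i^{(j)}`, `λ_i ≤ j ≤ m`.  `A_λ(K_λ)` is the
`K_λ`-subalgebra of `K_λ[z_1,…,z_{m+1}]/I_S` (variables indexed by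
`Σ i : Fin n, Fin (λ i)`) consisting of the images of the λ-symmetric polynomials.
Then the localization of `R_m/J_m(x_1⋯x_n)` at (the image of) `𝔭_λ` is isomorphic to
`A_λ(K_λ)` as a ring. -/
theorem jet_localization_iso_A
    (k : Type*) [Field k] [CharZero k] (n m : ℕ) (hn : 0 < n) (hm : 0 < m)
    (lam : Fin n → ℕ) (hlam : ∑ i, lam i = m + 1)
    (P : Polynomial (MvPolynomial (Fin n × Fin (m + 1)) k))
    (hP : P = ∏ i : Fin n, ∑ j : Fin (m + 1),
      Polynomial.C (X (i, j)) * Polynomial.X ^ (j : ℕ))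
    (J : Ideal (MvPolynomial (Fin n × Fin (m + 1)) k))
    (hJ : J = Ideal.span {q | ∃ d ≤ m, q = P.coeff d})
    (𝔭 : Ideal (MvPolynomial (Fin n × Fin (m + 1)) k))
    (h𝔭 : 𝔭 = Ideal.span
      {q | ∃ (i : Fin n) (j : Fin (m + 1)), (j : ℕ) < lam i ∧ q = X (i, j)})
    (IS : Ideal (MvPolynomial (Σ i : Fin n, Fin (lam i))
      (FractionRing (MvPolynomial {x : Fin n × Fin (m + 1) // lam x.1 ≤ (x.2 : ℕ)} k))))
    (hIS : IS = Ideal.span {q | q.IsSymmetric ∧ constantCoeff q = 0})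
    (S : Subalgebra
      (FractionRing (MvPolynomial {x : Fin n × Fin (m + 1) // lam x.1 ≤ (x.2 : ℕ)} k))
      (MvPolynomial (Σ i : Fin n, Fin (lam i))
        (FractionRing (MvPolynomial {x : Fin n × Fin (m + 1) // lam x.1 ≤ (x.2 : ℕ)} k))))
    (hS : S.carrier = {p | ∀ σ : Equiv.Perm (Σ i : Fin n, Fin (lam i)),
      (∀ x, (σ x).1 = x.1) → rename σ p = p})
    (A : Subalgebra
      (FractionRing (MvPolynomial {x : Fin n × Fin (m + 1) // lam x.1 ≤ (x.2 : ℕ)} k))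
      (MvPolynomial (Σ i : Fin n, Fin (lam i))
        (FractionRing (MvPolynomial {x : Fin n × Fin (m + 1) // lam x.1 ≤ (x.2 : ℕ)} k)) ⧸ IS))
    (hA : A = S.map (Ideal.Quotient.mkₐ _ IS)) :
    ∃ hp : (𝔭.map (Ideal.Quotient.mk J)).IsPrime,
      Nonempty (Localization (@Ideal.primeCompl _ _ (𝔭.map (Ideal.Quotient.mk J)) hp)
        ≃+* A) := by
  have : CharZero (FractionRing (MvPolynomial {x : Fin n × Fin (m + 1) //
      lam x.1 ≤ (x.2 : ℕ)} k)) :=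
    charZero_of_injective_algebraMap (IsFractionRing.injective
      (MvPolynomial {x : Fin n × Fin (m + 1) // lam x.1 ≤ (x.2 : ℕ)} k) _)
  subst hA
  exact nonempty_localization_ringEquiv hlam hP hJ h𝔭 hIS
    fun p ↦ by rw [← Subalgebra.mem_carrier, hS, Set.mem_ofPred_eq]
end
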